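/- arXiv:1907.02004 — 2 statements merged into one kernel-verified Lean document; each statement's English description precedes it below -/
import Mathlib

section
/- Let k be an integer with k ≥ 2 and let n ≥ 3 be divisible by k. Every balanced k-partite graph G on n vertices with minimum degree δ(G) ≥ ⌈n/2⌉ + ⌊(n+2)/(2·⌈(k+1)/2⌉)⌋ − n/k + 1 has a Hamiltonian cycle. -/
open SimpleGraph Finset

/-- `G` is a balanced `k`-partite graph: the vertex set can be partitioned into `k` parts,
each of size `|V|/k`, such that every edge joins vertices in different parts. -/
def IsBalancedKPartite {V : Type*} [Fintype V] [DecidableEq V]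
    (G : SimpleGraph V) (k : ℕ) : Prop :=
  ∃ P : V → Fin k,
    (∀ i : Fin k, (Finset.univ.filter fun v => P v = i).card = Fintype.card V / k) ∧
    (∀ u v : V, G.Adj u v → P u ≠ P v)

/-- The degree bound `⌈n/2⌉ + ⌊(n+2)/(2⌈(k+1)/2⌉)⌋ − n/k`, as a rational number. -/
def degBound (n k : ℕ) : ℚ :=
  (⌈(n : ℚ) / 2⌉ : ℚ) + (⌊((n : ℚ) + 2) / (2 * (⌈((k : ℚ) + 1) / 2⌉ : ℚ))⌋ : ℚ) - (n : ℚ) / k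

/-- `l` lists all the vertices once each, in the order of a closed walk of `G`. -/
def IsHamiltonianList {V : Type*} (G : SimpleGraph V) (l : List V) : Prop :=
  l.Nodup ∧ (∀ v, v ∈ l) ∧ (l ++ l).IsChain G.Adj

lemma List.IsChain.of_eq_append {α : Type*} {R : α → α → Prop} {l p m q : List α}
    (h : l.IsChain R) (hl : l = p ++ m ++ q) : m.IsChain R := by
  subst hl
  exact h.left_of_append.right_of_append

lemma List.isChain_append_append_comm {α : Type*} {R : α → α → Prop} {a b : List α}
    (h : ((a ++ b) ++ (a ++ b)).IsChain R) : ((b ++ a) ++ (b ++ a)).IsChain R := by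
  rcases eq_or_ne a [] with rfl | ha
  · simpa using h
  rcases eq_or_ne b [] with rfl | hb
  · simpa using h
  have h1 : (a ++ (b ++ a)).IsChain R := h.of_eq_append (p := []) (q := b) (by simp)
  have h2 : (b ++ a ++ b).IsChain R := h.of_eq_append (p := a) (q := []) (by simp)
  have h3 : (b ++ a).IsChain R := h2.of_eq_append (p := []) (q := b) (by simp)
  have := List.IsChain.append_overlap h2 (l₂ := b) (l₃ := a) h3 hb
  simpa using this

lemma IsHamiltonianList.rotate {V : Type*} {G : SimpleGraph V} {a b : List V}
    (h : IsHamiltonianList G (a ++ b)) : IsHamiltonianList G (b ++ a) :=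
  ⟨List.nodup_append_comm.1 h.1, fun v => by simpa [or_comm] using h.2.1 v,
    List.isChain_append_append_comm h.2.2⟩

lemma List.isChain_append_self {α : Type*} {R : α → α → Prop} {l : List α}
    (h : l.IsChain R) (hc : ∀ x ∈ l.getLast?, ∀ y ∈ l.head?, R x y) : (l ++ l).IsChain R :=
  h.append h hc

lemma IsHamiltonianList.isHamiltonian {V : Type*} [Fintype V] [DecidableEq V]
    {G : SimpleGraph V} {l : List V} (h : IsHamiltonianList G l) (hV : 3 ≤ Fintype.card V) :
    G.IsHamiltonian := by
  intro _
  obtain ⟨hnd, hmem, hch⟩ := h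
  have hlen : l.length = Fintype.card V := by
    rw [← List.toFinset_card_of_nodup hnd, show l.toFinset = Finset.univ by ext; simp [hmem]]
    rfl
  obtain ⟨a, t, rfl⟩ : ∃ a t, l = a :: t :=
    List.exists_cons_of_ne_nil (by rintro rfl; simp at hlen; omega)
  obtain ⟨t, b, rfl⟩ : ∃ t' b, t = t' ++ [b] := by
    rcases List.eq_nil_or_concat t with rfl | ⟨t', b, rfl⟩
    · simp at hlen; omega
    · exact ⟨t', b, by simp⟩
  have hba : G.Adj b a := by
    simp at hch
    exact hch.2.1
  have hc : (a :: (t ++ [b])).IsChain G.Adj := (List.isChain_append.1 hch).1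
  let p := Walk.ofSupport _ (by simp) hc
  have hp : p.support = a :: (t ++ [b]) := Walk.support_ofSupport _ _
  have e1 : (a :: (t ++ [b])).getLast (by simp) = b := by simp
  let q : G.Walk a b := p.copy (by simp) e1
  have hq : q.support = a :: (t ++ [b]) := (Walk.support_copy ..).trans hp
  refine ⟨b, Walk.cons hba q, ?_⟩
  rw [Walk.isHamiltonianCycle_iff_isCycle_and_support_count_tail_eq_one]
  have hqp : q.IsPath := by
    rw [Walk.isPath_def, hq]; exact hnd
  constructor
  · rw [Walk.cons_isCycle_iff]
    refine ⟨hqp, fun he => ?_⟩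
    have hl : q.length = Fintype.card V - 1 := by
      have := q.length_support
      rw [hq, hlen] at this; omega
    have := hqp.length_eq_one_of_mem_edges (by rw [Sym2.eq_swap]; exact he)
    omega
  · intro v
    rw [Walk.support_cons, List.tail_cons, hq]
    exact List.count_eq_one_of_mem hnd (hmem v)

lemma List.IsChain.exists_not_rel_of_not {α : Type*} {R S : α → α → Prop} {l : List α}
    (h : l.IsChain R) (hS : ¬ l.IsChain S) :
    ∃ a x y b, l = a ++ x :: y :: b ∧ R x y ∧ ¬ S x y := by
  rw [List.isChain_iff_forall_rel_of_append_cons_cons] at hS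
  push Not at hS
  obtain ⟨x, y, a, b, rfl, hxy⟩ := hS
  exact ⟨a, x, y, b, rfl, (List.isChain_append_cons_cons.1 h).2.1, hxy⟩

/-- A Hamiltonian list of `G` with one extra edge that is not Hamiltonian in `G`
gives a Hamiltonian path of `G` joining the ends of that edge. -/
lemma exists_hamiltonian_path_of_sup_edge {V : Type*} [Fintype V] {G : SimpleGraph V} {u v : V}
    {l : List V} (hV : 3 ≤ Fintype.card V) (hG : ∀ l, ¬ IsHamiltonianList G l)
    (h : IsHamiltonianList (G ⊔ edge u v) l) :
    ∃ x t y, (x :: (t ++ [y])).Nodup ∧ (∀ z, z ∈ x :: (t ++ [y])) ∧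
      (x :: (t ++ [y])).IsChain G.Adj ∧ (x = u ∧ y = v ∨ x = v ∧ y = u) := by
  classical
  have hcard : ∀ l : List V, l.Nodup → (∀ v, v ∈ l) → l.length = Fintype.card V := by
    intro l hnd hmem
    rw [← List.toFinset_card_of_nodup hnd, show l.toFinset = Finset.univ by ext; simp [hmem]]
    rfl
  -- a rotation that closes with the extra edge
  obtain ⟨x, t, y, hl, hxy⟩ : ∃ x t y, IsHamiltonianList (G ⊔ edge u v) (x :: (t ++ [y])) ∧
      ¬ G.Adj y x := by
    have hnot : ¬ (l ++ l).IsChain G.Adj := fun hc => hG l ⟨h.1, h.2.1, hc⟩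
    have hsplit : l ≠ [] := by
      rintro rfl
      have := hcard _ h.1 h.2.1
      simp at this; omega
    by_cases hc : l.IsChain G.Adj
    · obtain ⟨x, t, rfl⟩ := List.exists_cons_of_ne_nil hsplit
      rcases List.eq_nil_or_concat t with rfl | ⟨t', y, rfl⟩
      · have := hcard _ h.1 h.2.1
        simp at this; omega
      rw [List.concat_eq_append] at *
      refine ⟨x, t', y, h, fun ha => hnot ?_⟩
      refine List.isChain_append_self hc ?_
      rw [← List.cons_append, List.getLast?_concat]
      simpa using ha
    · obtain ⟨a, y, x, b, rfl, -, hn⟩ := h.2.2.left_of_append.exists_not_rel_of_not hc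
      have h' : IsHamiltonianList (G ⊔ edge u v) ((a ++ [y]) ++ (x :: b)) := by simpa using h
      exact ⟨x, b ++ a, y, by simpa using h'.rotate, hn⟩
  have key : ∀ p q, (G ⊔ edge u v).Adj p q → ¬ G.Adj p q → (p = u ∧ q = v ∨ p = v ∧ q = u) := by
    intro p q h1 h2
    rw [sup_adj, edge_adj] at h1
    tauto
  have hlen := hcard _ hl.1 hl.2.1
  have hyx : (G ⊔ edge u v).Adj y x := by
    have h' := hl.2.2
    simp only [List.cons_append, List.append_assoc, List.nil_append] at h'
    rw [← List.cons_append] at h'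
    exact (List.isChain_append_cons_cons.1 h').2.1
  have hcl := key _ _ hyx hxy
  refine ⟨x, t, y, hl.1, hl.2.1, ?_, by tauto⟩
  by_contra hc
  obtain ⟨a, p, q, b, he, hR, hn⟩ := hl.2.2.left_of_append.exists_not_rel_of_not hc
  have hpq := key _ _ hR hn
  have hne : u ≠ v := by
    rintro rfl
    simp only [or_self] at hcl
    have := hl.1
    simp [hcl.1, hcl.2] at this
  have hnd := hl.1
  have hx : p = x ∧ q = y ∨ p = y ∧ q = x := by
    rcases hpq with ⟨rfl, rfl⟩ | ⟨rfl, rfl⟩ <;> rcases hcl with ⟨rfl, rfl⟩ | ⟨rfl, rfl⟩ <;> tauto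
  have hnd' := hnd
  rw [he] at hnd'
  rcases hx with ⟨rfl, rfl⟩ | ⟨rfl, rfl⟩
  · cases a with
    | nil =>
      simp only [List.nil_append, List.cons.injEq, true_and] at he
      cases t with
      | nil => simp at hlen; omega
      | cons c t =>
        simp only [List.cons_append, List.cons.injEq] at he
        obtain ⟨rfl, -⟩ := he
        simp at hnd
    | cons c a =>
      simp only [List.cons_append, List.cons.injEq] at he
      obtain ⟨rfl, -⟩ := he
      simp at hnd'
  · cases a with
    | nil =>
      simp only [List.nil_append, List.cons.injEq] at he
      obtain ⟨rfl, -⟩ := he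
      rcases hcl with ⟨h1, h2⟩ | ⟨h1, h2⟩
      · exact hne (h1.symm.trans h2)
      · exact hne (h2.symm.trans h1)
    | cons c a =>
      simp only [List.cons_append, List.cons.injEq] at he
      obtain ⟨rfl, -⟩ := he
      simp at hnd'

/-- Above a non-Hamiltonian graph contained in `K` there is one that becomes Hamiltonian
whenever an edge of `K` is added. -/
lemma exists_maximal_not_hamiltonian {V : Type*} [Fintype V] {G K : SimpleGraph V} (hGK : G ≤ K)
    (hG : ∀ l, ¬ IsHamiltonianList G l) :
    ∃ H, G ≤ H ∧ H ≤ K ∧ (∀ l, ¬ IsHamiltonianList H l) ∧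
      ∀ u v, K.Adj u v → ¬ H.Adj u v → ∃ l, IsHamiltonianList (H ⊔ edge u v) l := by
  obtain ⟨H, hGH, hmax⟩ := Set.Finite.exists_le_maximal
    (s := {H : SimpleGraph V | H ≤ K ∧ ∀ l, ¬ IsHamiltonianList H l}) (Set.toFinite _) ⟨hGK, hG⟩
  refine ⟨H, hGH, hmax.prop.1, hmax.prop.2, fun u v huv hn => ?_⟩
  by_contra hcon
  push Not at hcon
  have hle : H ⊔ edge u v ≤ H := hmax.le_of_ge ⟨sup_le hmax.prop.1 ?_, hcon⟩ le_sup_left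
  · exact hn (hle (Or.inr ((edge_adj ..).2 ⟨Or.inl ⟨rfl, rfl⟩, huv.ne⟩)))
  · exact edge_le_iff .. |>.2 (Or.inr huv)

lemma List.Nodup.formPerm_apply_of_eq_append {α : Type*} [DecidableEq α] {l p q : List α} {x y : α}
    (h : l.Nodup) (hl : l = p ++ x :: y :: q) : l.formPerm x = y := by
  subst hl
  simpa using List.formPerm_apply_lt_getElem _ h p.length (by simp)

lemma List.Nodup.exists_eq_append_formPerm_symm {α : Type*} [DecidableEq α] {l : List α} {z : α}
    (h : l.Nodup) (hz : z ∈ l) (hh : z ∉ l.head?) :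
    ∃ p q, l = p ++ l.formPerm.symm z :: z :: q := by
  obtain ⟨s, q, rfl⟩ := List.append_of_mem hz
  rcases List.eq_nil_or_concat s with rfl | ⟨p, x, rfl⟩
  · simp at hh
  · rw [List.concat_eq_append] at *
    have he : p ++ [x] ++ z :: q = p ++ x :: z :: q := by simp
    have := h.formPerm_apply_of_eq_append he
    refine ⟨p, q, ?_⟩
    rw [← (Equiv.eq_symm_apply _).2 this, he]

section Crossing

variable {V : Type*} {G : SimpleGraph V}

lemma isChain_crossing {p Q r : List V} {x y : V}
    (h : (p ++ x :: (Q ++ y :: r)).IsChain G.Adj) (hx : ∀ v ∈ (y :: r).getLast?, G.Adj v x)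
    (hy : ∀ a ∈ (p ++ [x]).head?, G.Adj a y) :
    ((p ++ [x] ++ (y :: r).reverse) ++ (p ++ [x] ++ (y :: r).reverse)).IsChain G.Adj := by
  have h1 : (p ++ [x]).IsChain G.Adj := h.of_eq_append (p := []) (q := Q ++ y :: r) (by simp)
  have h2 : (y :: r).IsChain G.Adj := h.of_eq_append (p := p ++ x :: Q) (q := []) (by simp)
  have h3 : (y :: r).reverse.IsChain G.Adj := by
    rw [List.isChain_reverse]
    exact h2.imp fun _ _ hab => hab.symm
  refine List.isChain_append_self (h1.append h3 ?_) ?_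
  · intro a ha b hb
    rw [List.getLast?_concat] at ha
    rw [List.head?_reverse] at hb
    cases ha
    exact (hx b hb).symm
  · intro a ha b hb
    rw [List.reverse_cons, ← List.append_assoc, List.getLast?_concat] at ha
    cases ha
    refine (hy b ?_).symm
    rwa [List.head?_append_of_ne_nil _ (by simp)] at hb

/-- `l` lists all the vertices once each along a path of `G` from `u` to `v`. -/
structure IsHamiltonianPathList (G : SimpleGraph V) (u v : V) (l : List V) : Prop where
  nodup : l.Nodup
  mem : ∀ z, z ∈ l
  isChain : l.IsChain G.Adj
  head : l.head? = some u
  last : l.getLast? = some v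

lemma IsHamiltonianPathList.not_adj_symm_of_adj [DecidableEq V] {u v z : V} {l : List V}
    (h : IsHamiltonianPathList G u v l) (hG : ∀ l, ¬ IsHamiltonianList G l)
    (hz : G.Adj u z) : ¬ G.Adj v (l.formPerm.symm z) := by
  intro hv
  obtain ⟨p, q, hl⟩ := h.nodup.exists_eq_append_formPerm_symm (h.mem z) (by
    rw [h.head]; rintro ⟨⟩; exact G.irrefl hz)
  set x := l.formPerm.symm z
  have hperm : l.Perm (p ++ [x] ++ (z :: q).reverse) := by
    rw [hl, List.append_assoc]
    exact List.Perm.append_left _ (List.Perm.cons _ (List.reverse_perm _).symm)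
  refine hG (p ++ [x] ++ (z :: q).reverse)
    ⟨hperm.nodup_iff.1 h.nodup, fun w => hperm.mem_iff.1 (h.mem w),
      isChain_crossing (Q := []) (by simpa [← hl] using h.isChain) ?_ ?_⟩
  · intro w hw
    have := h.last
    rw [hl, List.getLast?_append_cons, List.getLast?_cons_cons] at this
    rw [this] at hw
    cases hw; exact hv
  · intro w hw
    have := h.head
    rw [hl, show p ++ x :: z :: q = (p ++ [x]) ++ z :: q by simp,
      List.head?_append_of_ne_nil _ (by simp)] at this
    rw [this] at hw
    cases hw; exact hz

lemma IsHamiltonianPathList.symm {u v : V} {l : List V}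
    (h : IsHamiltonianPathList G u v l) : IsHamiltonianPathList G v u l.reverse where
  nodup := List.nodup_reverse.2 h.nodup
  mem z := List.mem_reverse.2 (h.mem z)
  isChain := by
    rw [List.isChain_reverse]
    exact h.isChain.imp fun _ _ hab => hab.symm
  head := by rw [List.head?_reverse, h.last]
  last := by rw [List.getLast?_reverse, h.head]

lemma IsHamiltonianPathList.formPerm_last [DecidableEq V] {u v : V} {l : List V}
    (h : IsHamiltonianPathList G u v l) : l.formPerm v = u := by
  obtain ⟨t, rfl⟩ := List.head?_eq_some_iff.1 h.head
  have := h.last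
  rw [List.getLast?_eq_some_getLast (by simp)] at this
  cases this
  exact List.formPerm_apply_getLast _ _

lemma IsHamiltonianPathList.adj_formPerm_symm [DecidableEq V] {u v z : V} {l : List V}
    (h : IsHamiltonianPathList G u v l) (hz : z ≠ u) : G.Adj (l.formPerm.symm z) z := by
  obtain ⟨p, q, hl⟩ := h.nodup.exists_eq_append_formPerm_symm (h.mem z) (by
    rw [h.head]; rintro ⟨⟩; exact hz rfl)
  have := h.isChain
  rw [hl] at this
  exact (List.isChain_append_cons_cons.1 this).2.1

variable [Fintype V]

/-- Above a non-Hamiltonian graph contained in `K` there is one that has a Hamiltonian path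
between any two `K`-adjacent vertices which it does not join. -/
lemma exists_maximal_isHamiltonianPathList {K : SimpleGraph V} (hV : 3 ≤ Fintype.card V)
    (hGK : G ≤ K) (hG : ∀ l, ¬ IsHamiltonianList G l) :
    ∃ H, G ≤ H ∧ H ≤ K ∧ (∀ l, ¬ IsHamiltonianList H l) ∧
      ∀ u v, K.Adj u v → ¬ H.Adj u v → ∃ l, IsHamiltonianPathList H u v l := by
  obtain ⟨H, h1, h2, h3, h4⟩ := exists_maximal_not_hamiltonian hGK hG
  refine ⟨H, h1, h2, h3, fun u v huv hn => ?_⟩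
  obtain ⟨l, hl⟩ := h4 u v huv hn
  obtain ⟨x, t, y, hnd, hm, hch, hxy⟩ := exists_hamiltonian_path_of_sup_edge hV h3 hl
  have hp : IsHamiltonianPathList H x y (x :: (t ++ [y])) :=
    ⟨hnd, hm, hch, by simp, by rw [← List.cons_append, List.getLast?_concat]⟩
  rcases hxy with ⟨rfl, rfl⟩ | ⟨rfl, rfl⟩
  · exact ⟨_, hp⟩
  · exact ⟨_, hp.symm⟩

variable [DecidableEq V] [DecidableRel G.Adj]

lemma IsHamiltonianPathList.disjoint_map {u v : V} {l : List V}
    (h : IsHamiltonianPathList G u v l) (hG : ∀ l, ¬ IsHamiltonianList G l) :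
    Disjoint ((univ.filter (G.Adj u)).map l.formPerm.symm.toEmbedding)
      (univ.filter (G.Adj v)) := by
  rw [Finset.disjoint_left]
  intro x hx hv
  simp only [Finset.mem_map, Finset.mem_filter, Finset.mem_univ, true_and,
    Equiv.coe_toEmbedding] at hx hv
  obtain ⟨z, hz, rfl⟩ := hx
  exact h.not_adj_symm_of_adj hG hz hv

lemma IsHamiltonianPathList.last_notMem_map {u v : V} {l : List V}
    (h : IsHamiltonianPathList G u v l) :
    v ∉ (univ.filter (G.Adj u)).map l.formPerm.symm.toEmbedding := by
  simp only [Finset.mem_map_equiv, Equiv.symm_symm, h.formPerm_last]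
  simp

end Crossing

lemma exists_isHamiltonianList_of_card_le_two_mul {V : Type*} [Fintype V] [DecidableEq V]
    {G : SimpleGraph V} [DecidableRel G.Adj]
    (hV : 3 ≤ Fintype.card V) {d : ℕ} (hd : ∀ v, d ≤ #{w | G.Adj v w})
    (hn : Fintype.card V ≤ 2 * d) : ∃ l, IsHamiltonianList G l := by
  classical
  by_contra! hG
  obtain ⟨H, hGH, -, hH, hpath⟩ := exists_maximal_isHamiltonianPathList (K := ⊤) hV le_top hG
  by_cases hc : ∃ u v, u ≠ v ∧ ¬ H.Adj u v
  · obtain ⟨u, v, huv, hn⟩ := hc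
    obtain ⟨l, hl⟩ := hpath u v huv hn
    have hd' : ∀ v, d ≤ #{w | H.Adj v w} := fun v =>
      (hd v).trans (card_le_card fun w => by simpa using fun h => hGH h)
    have h1 : v ∉ (univ.filter (H.Adj u)).map l.formPerm.symm.toEmbedding ∪
        univ.filter (H.Adj v) := by
      rw [Finset.mem_union]
      rintro (h | h)
      · exact hl.last_notMem_map h
      · simp at h
    have h2 := card_lt_univ_of_notMem h1
    rw [card_union_of_disjoint (hl.disjoint_map hH), card_map] at h2
    have h3 : d ≤ #(univ.filter (H.Adj u)) := hd' u
    have h4 : d ≤ #(univ.filter (H.Adj v)) := hd' v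
    omega
  · push Not at hc
    have hlen : (univ : Finset V).toList.length = Fintype.card V := by simp
    have hnd := (univ : Finset V).nodup_toList
    refine hH (univ : Finset V).toList ⟨hnd, by simp, List.isChain_append_self ?_ ?_⟩
    · exact List.Pairwise.isChain (hnd.imp fun h => hc _ _ h)
    · intro x hx y hy
      generalize (univ : Finset V).toList = l at *
      cases l with
      | nil => simp at hx
      | cons a t =>
        rcases List.eq_nil_or_concat t with rfl | ⟨t, b, rfl⟩
        · simp at hlen; omega
        · rw [List.concat_eq_append] at *
          rw [← List.cons_append, List.getLast?_concat] at hx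
          simp at hx hy
          subst hx hy
          refine hc _ _ ?_
          rintro rfl
          simp at hnd

lemma exists_isHamiltonianList_of_bipartite {V : Type*} [Fintype V] [DecidableEq V]
    {G : SimpleGraph V} [DecidableRel G.Adj] (P : V → Fin 2) {m : ℕ}
    (hP : ∀ i, #{v | P v = i} = m) (hGP : ∀ u v, G.Adj u v → P u ≠ P v)
    (hV : 3 ≤ Fintype.card V) {d : ℕ} (hd : ∀ v, d ≤ #{w | G.Adj v w})
    (hn : m < 2 * d) : ∃ l, IsHamiltonianList G l := by
  classical
  by_contra! hG
  obtain ⟨H, hGH, hHK, hH, hpath⟩ :=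
    exists_maximal_isHamiltonianPathList (K := (⊤ : SimpleGraph (Fin 2)).comap P) hV
      (fun u v h => by simpa using hGP u v h) hG
  have hHP : ∀ u v, H.Adj u v → P u ≠ P v := fun u v h => by simpa using hHK h
  by_cases hc : ∃ u v, P u ≠ P v ∧ ¬ H.Adj u v
  · obtain ⟨u, v, huv, hn'⟩ := hc
    obtain ⟨l, hl⟩ := hpath u v (by simpa using huv) hn'
    have hd' : ∀ v, d ≤ #(univ.filter (H.Adj v)) := fun v =>
      (hd v).trans (card_le_card fun w => by simpa using fun h => hGH h)
    have h1 : (univ.filter (H.Adj u)).map l.formPerm.symm.toEmbedding ∪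
        univ.filter (H.Adj v) ⊆ univ.filter (fun w => P w = P u) := by
      intro x hx
      simp only [mem_union, mem_map, mem_filter, mem_univ, true_and,
        Equiv.coe_toEmbedding] at hx ⊢
      rcases hx with ⟨z, hz, rfl⟩ | hx
      · have := hHP _ _ hz
        have := hHP _ _ (hl.adj_formPerm_symm hz.ne')
        omega
      · have := hHP _ _ hx
        omega
    have h2 := card_le_card h1
    rw [card_union_of_disjoint (hl.disjoint_map hH), card_map, hP] at h2
    have := hd' u
    have := hd' v
    omega
  · push Not at hc
    have hm : ∀ v, #(univ.filter (H.Adj v)) = m := by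
      intro v
      rw [← hP (P v + 1)]
      congr 1
      ext w
      simp only [mem_filter, mem_univ, true_and]
      have h1 : P v ≠ P w ↔ P w = P v + 1 := by
        generalize P v = a
        generalize P w = b
        revert a b
        decide
      exact ⟨fun h => h1.1 (hHP _ _ h), fun h => hc _ _ (h1.2 h)⟩
    have hcard : Fintype.card V = 2 * m := by
      rw [← Finset.card_univ, card_eq_sum_card_fiberwise (f := P) (t := univ) (by simp)]
      simp [hP]
    obtain ⟨l, hl⟩ := exists_isHamiltonianList_of_card_le_two_mul (G := H) hV
      (fun v => (hm v).ge) hcard.le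
    exact hH l hl

lemma List.exists_eq_append_of_mem_of_ne {α : Type*} {l : List α} {x y : α} (hx : x ∈ l)
    (hy : y ∈ l) (hxy : x ≠ y) :
    ∃ p Q r, l = p ++ x :: (Q ++ y :: r) ∨ l = p ++ y :: (Q ++ x :: r) := by
  obtain ⟨s, t, rfl⟩ := List.append_of_mem hx
  rw [List.mem_append, List.mem_cons] at hy
  rcases hy with hy | hy | hy
  · obtain ⟨p, Q, rfl⟩ := List.append_of_mem hy
    exact ⟨p, Q, t, Or.inr (by simp)⟩
  · exact absurd hy.symm hxy
  · obtain ⟨Q, r, rfl⟩ := List.append_of_mem hy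
    exact ⟨s, Q, r, Or.inl rfl⟩

/-- The vertices of `G` are split into the list `C`, in the order of a closed walk, and the
nonempty list `Q`, in the order of a walk. -/
structure IsCyclePathCover {V : Type*} (G : SimpleGraph V) (C Q : List V) : Prop where
  nodup : (C ++ Q).Nodup
  mem : ∀ z, z ∈ C ++ Q
  isChain_cycle : (C ++ C).IsChain G.Adj
  isChain_path : Q.IsChain G.Adj
  ne_nil : Q ≠ []

section

variable {V : Type*} {G : SimpleGraph V} [Fintype V] [DecidableEq V] [DecidableRel G.Adj]

lemma IsHamiltonianPathList.exists_isCyclePathCover {a v : V} {l : List V} {d : ℕ}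
    (h : IsHamiltonianPathList G a v l) (hG : ∀ l, ¬ IsHamiltonianList G l)
    (hd : ∀ v, d ≤ #{w | G.Adj v w})
    (hex : ∃ p x Q y r, l = p ++ x :: (Q ++ y :: r) ∧ G.Adj v x ∧ G.Adj a y) :
    ∃ C Q, IsCyclePathCover G C Q ∧ 2 * d + Q.length ≤ Fintype.card V := by
  classical
  have hex' : ∃ q, ∃ p x Q y r, l = p ++ x :: (Q ++ y :: r) ∧ G.Adj v x ∧ G.Adj a y ∧
      Q.length = q := by
    obtain ⟨p, x, Q, y, r, h1, h2, h3⟩ := hex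
    exact ⟨_, p, x, Q, y, r, h1, h2, h3, rfl⟩
  obtain ⟨p, x, Q, y, r, hl, hx, hy, hq⟩ := Nat.find_spec hex'
  have hmin : ∀ p' x' Q' y' r', l = p' ++ x' :: (Q' ++ y' :: r') → G.Adj v x' → G.Adj a y' →
      Q.length ≤ Q'.length := fun p' x' Q' y' r' h1 h2 h3 =>
    hq ▸ Nat.find_min' hex' ⟨p', x', Q', y', r', h1, h2, h3, rfl⟩
  have hperm : l.Perm ((p ++ [x] ++ (y :: r).reverse) ++ Q) := by
    rw [hl]
    have h1 : ((y :: r).reverse ++ Q).Perm (Q ++ y :: r) :=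
      List.perm_append_comm.trans (List.Perm.append_left _ (List.reverse_perm _))
    have h2 := (h1.symm.cons x).append_left p
    simpa using h2
  have hcyc : ((p ++ [x] ++ (y :: r).reverse) ++ (p ++ [x] ++ (y :: r).reverse)).IsChain G.Adj := by
    refine isChain_crossing (Q := Q) (by simpa [← hl] using h.isChain) ?_ ?_
    · intro w hw
      have := h.last
      rw [hl, show p ++ x :: (Q ++ y :: r) = (p ++ x :: Q) ++ y :: r by simp,
        List.getLast?_append_cons] at this
      rw [this] at hw
      cases hw; exact hx
    · intro w hw
      have := h.head
      rw [hl, show p ++ x :: (Q ++ y :: r) = (p ++ [x]) ++ (Q ++ y :: r) by simp,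
        List.head?_append_of_ne_nil _ (by simp)] at this
      rw [this] at hw
      cases hw; exact hy
  have hnd := hperm.nodup_iff.1 h.nodup
  have hmem := fun z => hperm.mem_iff.1 (h.mem z)
  have hQ0 : Q ≠ [] := by
    rintro rfl
    exact hG _ ⟨by simpa using hnd, by simpa using hmem, hcyc⟩
  have hQl : Q.IsChain G.Adj := by
    have h1 := h.isChain
    rw [hl] at h1
    exact h1.of_eq_append (p := p ++ [x]) (q := y :: r) (by simp)
  refine ⟨_, Q, ⟨hnd, hmem, hcyc, hQl, hQ0⟩, ?_⟩
  have hvQ : v ∉ Q := by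
    have h1 := h.last
    rw [hl, show p ++ x :: (Q ++ y :: r) = (p ++ x :: Q) ++ y :: r by simp,
      List.getLast?_append_cons] at h1
    have h2 : v ∈ (y :: r).reverse := List.mem_reverse.2 (List.mem_of_getLast? h1)
    exact fun hv => List.disjoint_of_nodup_append hnd (List.mem_append_right _ h2) hv
  have hQv : ∀ w ∈ Q, ¬ G.Adj v w := by
    intro w hw hvw
    obtain ⟨s, t, rfl⟩ := List.append_of_mem hw
    have := hmin (p ++ x :: s) w t y r (by rw [hl]; simp) hvw hy
    simp at this; omega
  have hQa : ∀ w ∈ Q, ¬ G.Adj a w := by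
    intro w hw haw
    obtain ⟨s, t, rfl⟩ := List.append_of_mem hw
    have := hmin p x s w (t ++ y :: r) (by rw [hl]; simp) hx haw
    simp at this
  have hdisj : Disjoint (((univ.filter (G.Adj a)).map l.formPerm.symm.toEmbedding) ∪
      (univ.filter (G.Adj v))) (insert v Q.dropLast.toFinset) := by
    rw [Finset.disjoint_left]
    intro w hw hw'
    rw [Finset.mem_insert, List.mem_toFinset] at hw'
    rcases hw' with rfl | hw'
    · rw [Finset.mem_union] at hw
      rcases hw with hw | hw
      · exact h.last_notMem_map hw
      · simp at hw
    · obtain ⟨s, t, hst⟩ := List.append_of_mem hw'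
      have hQ' := List.dropLast_append_getLast hQ0
      rw [hst] at hQ'
      obtain ⟨w', t', ht'⟩ : ∃ w' t', t ++ [Q.getLast hQ0] = w' :: t' :=
        List.exists_cons_of_ne_nil (by simp)
      have hQs : Q = s ++ w :: w' :: t' := by
        rw [← ht']; simpa using hQ'.symm
      have hσ : l.formPerm w = w' := h.nodup.formPerm_apply_of_eq_append
        (p := p ++ x :: s) (q := t' ++ y :: r) (by rw [hl, hQs]; simp)
      rw [Finset.mem_union, Finset.mem_map_equiv, Equiv.symm_symm, hσ] at hw
      simp only [mem_filter, mem_univ, true_and] at hw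
      rcases hw with hw | hw
      · exact hQa w' (by rw [hQs]; simp) hw
      · exact hQv w (by rw [hQs]; simp) hw
  have hc := Finset.card_le_univ ((((univ.filter (G.Adj a)).map l.formPerm.symm.toEmbedding) ∪
      (univ.filter (G.Adj v))) ∪ (insert v Q.dropLast.toFinset))
  have hQnd : Q.Nodup := (List.nodup_append.1 hnd).2.1
  rw [card_union_of_disjoint hdisj, card_union_of_disjoint (h.disjoint_map hG), card_map,
    card_insert_of_notMem, List.toFinset_card_of_nodup (hQnd.sublist (List.dropLast_sublist _)),
    List.length_dropLast] at hc
  · have h1 : d ≤ #(univ.filter (G.Adj a)) := hd a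
    have h2 : d ≤ #(univ.filter (G.Adj v)) := hd v
    have := List.length_pos_of_ne_nil hQ0
    omega
  · rw [List.mem_toFinset]
    exact fun hv => hvQ (List.mem_of_mem_dropLast hv)

lemma exists_isCyclePathCover_of_path {ι : Type*} [DecidableEq ι] {P : V → ι} {m d : ℕ} {u v : V}
    {l : List V} (h : IsHamiltonianPathList G u v l) (hG : ∀ l, ¬ IsHamiltonianList G l)
    (hd : ∀ v, d ≤ #{w | G.Adj v w}) (hGP : ∀ u v, G.Adj u v → P u ≠ P v)
    (hm : #{w | P w = P v} = m) (hdm : Fintype.card V + 2 ≤ 2 * d + m) :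
    ∃ C Q, IsCyclePathCover G C Q ∧ 2 * d + Q.length ≤ Fintype.card V := by
  classical
  obtain ⟨a, haP, haA⟩ : ∃ a, P a = P v ∧
      a ∈ (univ.filter (G.Adj u)).map l.formPerm.symm.toEmbedding := by
    by_contra! hcon
    have h1 : Disjoint ((univ.filter (G.Adj u)).map l.formPerm.symm.toEmbedding ∪
        univ.filter (G.Adj v)) (univ.filter fun w => P w = P v) := by
      rw [Finset.disjoint_left]
      intro w hw hw'
      simp only [mem_filter, mem_univ, true_and] at hw'
      rw [Finset.mem_union] at hw
      rcases hw with hw | hw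
      · exact hcon w hw' hw
      · simp only [mem_filter, mem_univ, true_and] at hw
        exact hGP _ _ hw hw'.symm
    have hc := Finset.card_le_univ (((univ.filter (G.Adj u)).map l.formPerm.symm.toEmbedding ∪
        univ.filter (G.Adj v)) ∪ (univ.filter fun w => P w = P v))
    rw [card_union_of_disjoint h1, card_union_of_disjoint (h.disjoint_map hG), card_map, hm] at hc
    have h1 : d ≤ #(univ.filter (G.Adj u)) := hd u
    have h2 : d ≤ #(univ.filter (G.Adj v)) := hd v
    omega
  have hav : a ≠ v := by rintro rfl; exact h.last_notMem_map haA
  rw [Finset.mem_map_equiv, Equiv.symm_symm, mem_filter] at haA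
  obtain ⟨-, haz⟩ := haA
  obtain ⟨p, q, hl⟩ := h.nodup.exists_eq_append_formPerm_symm (h.mem (l.formPerm a))
    (by rw [h.head]; intro hh; exact haz.ne (Option.some.inj hh))
  rw [Equiv.symm_apply_apply] at hl
  set z := l.formPerm a
  have hl' : l = (p ++ [a]) ++ z :: q := by rw [hl]; simp
  have hperm : l.Perm ((p ++ [a]).reverse ++ z :: q) := by
    rw [hl']; exact List.Perm.append_right _ (List.reverse_perm _).symm
  have hhead : (p ++ [a]).head? = some u := by
    have := h.head
    rwa [hl', List.head?_append_of_ne_nil _ (by simp)] at this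
  have hlast : (z :: q).getLast? = some v := by
    have := h.last
    rwa [hl', List.getLast?_append_cons] at this
  have hch := h.isChain
  rw [hl', List.isChain_append] at hch
  have hpath : IsHamiltonianPathList G a v ((p ++ [a]).reverse ++ z :: q) :=
    { nodup := hperm.nodup_iff.1 h.nodup
      mem := fun z => hperm.mem_iff.1 (h.mem z)
      isChain := by
        refine List.isChain_append.2 ⟨?_, hch.2.1, ?_⟩
        · rw [List.isChain_reverse]
          exact hch.1.imp fun _ _ hab => hab.symm
        · intro x hx y hy
          rw [List.getLast?_reverse, hhead] at hx
          cases hx; cases hy; exact haz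
      head := by simp
      last := by rwa [List.getLast?_append_cons] }
  refine hpath.exists_isCyclePathCover hG hd ?_
  have hcap : 1 < #(univ.filter (G.Adj a) ∩ univ.filter (G.Adj v)) := by
    have h1 : Disjoint (univ.filter (G.Adj a) ∪ univ.filter (G.Adj v))
        (univ.filter fun w => P w = P v) := by
      rw [Finset.disjoint_left]
      intro w hw hw'
      simp only [mem_union, mem_filter, mem_univ, true_and] at hw hw'
      rcases hw with hw | hw
      · exact hGP _ _ hw (haP.trans hw'.symm)
      · exact hGP _ _ hw hw'.symm
    have hc := Finset.card_le_univ ((univ.filter (G.Adj a) ∪ univ.filter (G.Adj v)) ∪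
      (univ.filter fun w => P w = P v))
    rw [card_union_of_disjoint h1, hm] at hc
    have h3 := card_union_add_card_inter (univ.filter (G.Adj a)) (univ.filter (G.Adj v))
    have h1 : d ≤ #(univ.filter (G.Adj a)) := hd a
    have h2 : d ≤ #(univ.filter (G.Adj v)) := hd v
    omega
  obtain ⟨z₁, h1, z₂, h2, hne⟩ := Finset.one_lt_card.1 hcap
  simp only [mem_inter, mem_filter, mem_univ, true_and] at h1 h2
  obtain ⟨p', Q, r, h' | h'⟩ :=
    List.exists_eq_append_of_mem_of_ne (hpath.mem z₁) (hpath.mem z₂) hne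
  · exact ⟨p', z₁, Q, z₂, r, h', h1.2, h2.1⟩
  · exact ⟨p', z₂, Q, z₁, r, h', h2.2, h1.1⟩

end

namespace IsCyclePathCover

variable {V : Type*} {G : SimpleGraph V}

lemma rotate {a b Q : List V} (h : IsCyclePathCover G (a ++ b) Q) :
    IsCyclePathCover G (b ++ a) Q := by
  have hperm : (a ++ b ++ Q).Perm (b ++ a ++ Q) := List.Perm.append_right _ List.perm_append_comm
  exact ⟨hperm.nodup_iff.1 h.nodup, fun z => hperm.mem_iff.1 (h.mem z),
    List.isChain_append_append_comm h.isChain_cycle, h.isChain_path, h.ne_nil⟩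

lemma reverse_path {C Q : List V} (h : IsCyclePathCover G C Q) :
    IsCyclePathCover G C Q.reverse := by
  have hperm : (C ++ Q).Perm (C ++ Q.reverse) := List.Perm.append_left _ (List.reverse_perm _).symm
  refine ⟨hperm.nodup_iff.1 h.nodup, fun z => hperm.mem_iff.1 (h.mem z), h.isChain_cycle, ?_, ?_⟩
  · rw [List.isChain_reverse]
    exact h.isChain_path.imp fun _ _ hab => hab.symm
  · simpa using h.ne_nil

/-- Replacing the segment `I` of the cycle by `S` in a cover with a shortest path. -/
lemma length_le_of_perm {z y : V} {I rest Q S T : List V}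
    (h : IsCyclePathCover G (z :: (I ++ y :: rest)) Q) (hG : ∀ l, ¬ IsHamiltonianList G l)
    (hmin : ∀ C' Q', IsCyclePathCover G C' Q' → Q.length ≤ Q'.length)
    (hS : S.IsChain G.Adj) (hT : T.IsChain G.Adj) (hperm : (I ++ Q).Perm (S ++ T))
    (hne : S ≠ []) (hz : ∀ a ∈ S.head?, G.Adj z a) (hy : ∀ b ∈ S.getLast?, G.Adj b y) :
    Q.length ≤ T.length := by
  have hp : (z :: (I ++ y :: rest) ++ Q).Perm (z :: (S ++ y :: rest) ++ T) := by
    have h1 : (I ++ y :: rest ++ Q).Perm (I ++ Q ++ y :: rest) := by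
      rw [List.append_assoc, List.append_assoc]
      exact List.Perm.append_left _ List.perm_append_comm
    have h2 : (S ++ y :: rest ++ T).Perm (S ++ T ++ y :: rest) := by
      rw [List.append_assoc, List.append_assoc]
      exact List.Perm.append_left _ List.perm_append_comm
    exact (h1.trans ((hperm.append_right _).trans h2.symm)).cons z
  have hnd := hp.nodup_iff.1 h.nodup
  have hmem := fun w => hp.mem_iff.1 (h.mem w)
  have hch := h.isChain_cycle
  have hcyc : (z :: (S ++ y :: rest) ++ z :: (S ++ y :: rest)).IsChain G.Adj := by
    have h1 : (y :: rest ++ [z]).IsChain G.Adj :=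
      hch.of_eq_append (p := z :: I) (q := I ++ y :: rest) (by simp)
    have h2 : (S ++ (y :: rest ++ [z])).IsChain G.Adj := by
      refine hS.append h1 ?_
      intro a ha b hb
      simp only [List.cons_append, List.head?_cons, Option.mem_def, Option.some.injEq] at hb
      exact hb ▸ hy a ha
    have h3 : (S ++ y :: rest).IsChain G.Adj := h2.of_eq_append (p := []) (q := [z]) (by simp)
    refine List.isChain_append_self (List.isChain_cons.2 ⟨?_, h3⟩) ?_
    · intro a ha
      rw [List.head?_append_of_ne_nil _ hne] at ha
      exact hz a ha
    · intro a ha b hb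
      rw [← List.cons_append, List.getLast?_append_cons] at ha
      exact (List.isChain_append.1 h1).2.2 a ha b (by simpa using hb)
  rcases eq_or_ne T [] with rfl | hT0
  · exact absurd ⟨by simpa using hnd, by simpa using hmem, hcyc⟩ (hG _)
  · exact hmin _ _ ⟨hnd, hmem, hcyc, hT, hT0⟩

lemma not_adj_and_adj {z y a : V} {rest Q : List V}
    (h : IsCyclePathCover G (z :: y :: rest) (a :: Q)) (hG : ∀ l, ¬ IsHamiltonianList G l)
    (hmin : ∀ C' Q', IsCyclePathCover G C' Q' → (a :: Q).length ≤ Q'.length) :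
    ¬ (G.Adj a z ∧ G.Adj a y) := by
  rintro ⟨haz, hay⟩
  have := h.length_le_of_perm (I := []) (S := [a]) (T := Q) hG hmin (by simp)
    h.isChain_path.tail (by simp) (by simp) (by simpa using haz.symm) (by simpa using hay)
  simp at this

lemma exists_rotation [DecidableEq V] {C Q : List V} (h : IsCyclePathCover G C Q)
    (hC : 4 ≤ C.length) {z : V} (hz : z ∈ C) :
    ∃ rest, IsCyclePathCover G (z :: C.formPerm z :: C.formPerm (C.formPerm z) ::
      C.formPerm (C.formPerm (C.formPerm z)) :: rest) Q := by
  obtain ⟨s, t, rfl⟩ := List.append_of_mem hz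
  have h1 := h.rotate
  have hnd : (s ++ z :: t).Nodup := (List.nodup_append.1 h.nodup).1
  have hnd' : (z :: t ++ s).Nodup := (List.nodup_append.1 h1.nodup).1
  have hrot : (s ++ z :: t).IsRotated (z :: t ++ s) := ⟨s.length, by simp⟩
  have hσ := List.formPerm_eq_of_isRotated hnd hrot
  have hlen : 4 ≤ (z :: t ++ s).length := by
    simp only [List.length_append, List.length_cons] at hC ⊢; omega
  rw [hσ]
  rw [List.cons_append] at *
  rcases hts : t ++ s with _ | ⟨y₁, _ | ⟨y₂, _ | ⟨y₃, rest⟩⟩⟩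
  · simp [hts] at hlen
  · simp [hts] at hlen
  · simp [hts] at hlen
  · rw [hts] at h1 hnd'
    have e1 := hnd'.formPerm_apply_of_eq_append (p := []) rfl
    have e2 := hnd'.formPerm_apply_of_eq_append (p := [z]) rfl
    have e3 := hnd'.formPerm_apply_of_eq_append (p := [z, y₁]) rfl
    rw [e1, e2, e3]
    exact ⟨rest, h1⟩

section Count

variable [Fintype V] [DecidableEq V] [DecidableRel G.Adj]

lemma le_card_filter_add {C Q : List V} {a : V} {d : ℕ} (h : IsCyclePathCover G C (a :: Q))
    (hd : ∀ v, d ≤ #{w | G.Adj v w}) : d ≤ #{w ∈ C.toFinset | G.Adj a w} + Q.length := by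
  refine (hd a).trans ((card_le_card (t := {w ∈ C.toFinset | G.Adj a w} ∪ Q.toFinset) ?_).trans
    ((card_union_le _ _).trans (Nat.add_le_add_left (List.toFinset_card_le _) _)))
  intro w hw
  simp only [mem_filter, mem_univ, true_and] at hw
  have := h.mem w
  simp only [List.mem_append, List.mem_cons] at this
  simp only [mem_union, mem_filter, List.mem_toFinset]
  rcases this with h | rfl | h
  · exact Or.inl ⟨h, hw⟩
  · simp at hw
  · exact Or.inr h

/-- A cycle and a path covering all the vertices, with the path as short as possible:
under suitable degree conditions the path is a single vertex. -/
lemma length_eq_one_of_minimal {C Q : List V} {d : ℕ} (h : IsCyclePathCover G C Q)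
    (hG : ∀ l, ¬ IsHamiltonianList G l)
    (hmin : ∀ C' Q', IsCyclePathCover G C' Q' → Q.length ≤ Q'.length)
    (hd : ∀ v, d ≤ #{w | G.Adj v w}) (hQ : 2 * d + Q.length ≤ Fintype.card V)
    (h3 : Fintype.card V + 1 < 3 * d) (h10 : 4 * Fintype.card V < 10 * d + 4) :
    Q.length = 1 := by
  by_contra hQ1
  have hlen : C.length + Q.length = Fintype.card V := by
    rw [← List.length_append, ← List.toFinset_card_of_nodup h.nodup,
      show (C ++ Q).toFinset = univ by ext z; simpa using h.mem z, card_univ]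
  obtain ⟨a, R, rfl⟩ := List.exists_cons_of_ne_nil h.ne_nil
  rcases List.eq_nil_or_concat R with rfl | ⟨R, b, rfl⟩
  · simp at hQ1
  rw [List.concat_eq_append] at *
  simp only [List.length_cons, List.length_append, List.length_nil] at hQ hlen
  have hrev : (a :: (R ++ [b])).reverse = b :: (R.reverse ++ [a]) := by simp
  have hC4 : 4 ≤ C.length := by omega
  have hnda : ∀ z ∈ C, ¬ (G.Adj a z ∧ G.Adj a (C.formPerm z)) := by
    intro z hz
    obtain ⟨rest, hr⟩ := h.exists_rotation hC4 hz
    exact hr.not_adj_and_adj hG hmin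
  have hndb : ∀ z ∈ C, ¬ (G.Adj b z ∧ G.Adj b (C.formPerm z)) := by
    intro z hz
    obtain ⟨rest, hr⟩ := h.exists_rotation hC4 hz
    have hr' := hr.reverse_path
    rw [hrev] at hr'
    exact hr'.not_adj_and_adj hG (by simpa using hmin)
  have hab1 : ∀ z ∈ C, ¬ (G.Adj a z ∧ G.Adj b (C.formPerm z)) := by
    rintro z hz ⟨h1, h2⟩
    obtain ⟨rest, hr⟩ := h.exists_rotation hC4 hz
    have := hr.length_le_of_perm (I := []) (S := a :: (R ++ [b])) (T := []) hG hmin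
      hr.isChain_path (by simp) (by simp) (by simp) (by simpa using h1.symm)
      (by rw [← List.cons_append, List.getLast?_concat]; simpa using h2)
    simp at this
  have hab2 : ∀ z ∈ C, ¬ (G.Adj a z ∧ G.Adj b (C.formPerm (C.formPerm z))) := by
    rintro z hz ⟨h1, h2⟩
    obtain ⟨rest, hr⟩ := h.exists_rotation hC4 hz
    have := hr.length_le_of_perm (I := [_]) (S := a :: (R ++ [b])) (T := [_]) hG hmin
      hr.isChain_path (by simp) List.perm_append_comm (by simp) (by simpa using h1.symm)
      (by rw [← List.cons_append, List.getLast?_concat]; simpa using h2)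
    simp at this
  have hab3 : R ≠ [] → ∀ z ∈ C,
      ¬ (G.Adj a z ∧ G.Adj b (C.formPerm (C.formPerm (C.formPerm z)))) := by
    rintro hR z hz ⟨h1, h2⟩
    obtain ⟨rest, hr⟩ := h.exists_rotation hC4 hz
    have h5 := hr.length_le_of_perm (I := [_, _]) (S := a :: (R ++ [b])) (T := [_, _]) hG hmin
      hr.isChain_path (by have := hr.isChain_cycle; simp at this ⊢; tauto)
      List.perm_append_comm (by simp) (by simpa using h1.symm)
      (by rw [← List.cons_append, List.getLast?_concat]; simpa using h2)
    have h6 := List.length_pos_of_ne_nil hR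
    simp only [List.length_cons, List.length_append, List.length_nil] at h5
    omega
  set σ := C.formPerm with hσ
  have hσC : ∀ z ∈ C, σ z ∈ C := fun z hz => List.formPerm_apply_mem_of_mem hz
  set A : Finset V := {w ∈ C.toFinset | G.Adj a w} with hA
  set B : Finset V := {w ∈ C.toFinset | G.Adj b w} with hB
  have hAd : d ≤ #A + (R ++ [b]).length := h.le_card_filter_add hd
  have hBd : d ≤ #B + (R.reverse ++ [a]).length :=
    (show IsCyclePathCover G C (b :: (R.reverse ++ [a])) from
      hrev ▸ h.reverse_path).le_card_filter_add hd
  have memA : ∀ w, w ∈ A ↔ w ∈ C ∧ G.Adj a w := by simp [hA]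
  have memB : ∀ w, w ∈ B ↔ w ∈ C ∧ G.Adj b w := by simp [hB]
  set s : Finset V → Finset V := fun M => M.map σ.toEmbedding with hs
  have hsC : ∀ M ⊆ C.toFinset, s M ⊆ C.toFinset := by
    intro M hM w hw
    simp only [hs, mem_map, Equiv.coe_toEmbedding] at hw
    obtain ⟨z, hz, rfl⟩ := hw
    exact List.mem_toFinset.2 (hσC z (List.mem_toFinset.1 (hM hz)))
  have hsd : ∀ M N, Disjoint M N → Disjoint (s M) (s N) := fun M N hMN =>
    (disjoint_map _).2 hMN
  have hsc : ∀ M, #(s M) = #M := fun M => card_map _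
  have hAC : A ⊆ C.toFinset := filter_subset _ _
  have hBC : B ⊆ C.toFinset := filter_subset _ _
  have dis : ∀ M N : Finset V, (∀ z ∈ M, σ z ∉ N) → Disjoint (s M) N := by
    intro M N hMN
    rw [Finset.disjoint_left]
    intro w hw
    simp only [hs, mem_map, Equiv.coe_toEmbedding] at hw
    obtain ⟨z, hz, rfl⟩ := hw
    exact hMN z hz
  have dA : Disjoint (s A) A := dis _ _ fun z hz hz' =>
    hnda z ((memA z).1 hz).1 ⟨((memA z).1 hz).2, ((memA _).1 hz').2⟩
  have dB : Disjoint (s B) B := dis _ _ fun z hz hz' =>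
    hndb z ((memB z).1 hz).1 ⟨((memB z).1 hz).2, ((memB _).1 hz').2⟩
  have dAB1 : Disjoint (s A) B := dis _ _ fun z hz hz' =>
    hab1 z ((memA z).1 hz).1 ⟨((memA z).1 hz).2, ((memB _).1 hz').2⟩
  have dAB2 : Disjoint (s (s A)) B := dis _ _ fun z hz hz' => by
    simp only [hs, mem_map, Equiv.coe_toEmbedding] at hz
    obtain ⟨z, hz, rfl⟩ := hz
    exact hab2 z ((memA z).1 hz).1 ⟨((memA z).1 hz).2, ((memB _).1 hz').2⟩
  have hCc : #C.toFinset = C.length :=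
    List.toFinset_card_of_nodup (List.nodup_append.1 h.nodup).1
  rcases eq_or_ne R [] with rfl | hR
  · have hc := card_le_card (union_subset (union_subset (hsC _ (hsC _ hAC)) (hsC _ hAC)) hBC)
    rw [card_union_of_disjoint, card_union_of_disjoint (hsd _ _ dA), hsc, hsc, hCc] at hc
    · simp at *; omega
    · exact disjoint_union_left.2 ⟨dAB2, dAB1⟩
  · have dAB3 : Disjoint (s (s (s A))) B := dis _ _ fun z hz hz' => by
      simp only [hs, mem_map, Equiv.coe_toEmbedding, exists_exists_and_eq_and] at hz
      obtain ⟨z, hz, rfl⟩ := hz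
      exact hab3 hR z ((memA z).1 hz).1 ⟨((memA z).1 hz).2, ((memB _).1 hz').2⟩
    have hc := card_le_card (union_subset (union_subset (hsC _ (hsC _ (hsC _ hAC)))
      (hsC _ (hsC _ hAC))) (union_subset (hsC _ hBC) hBC))
    rw [card_union_of_disjoint, card_union_of_disjoint (hsd _ _ (hsd _ _ dA)),
      card_union_of_disjoint dB, hsc, hsc, hsc, hsc, hCc] at hc
    · simp at *; omega
    · exact disjoint_union_left.2 ⟨disjoint_union_right.2 ⟨hsd _ _ dAB2, dAB3⟩,
        disjoint_union_right.2 ⟨hsd _ _ dAB1, dAB2⟩⟩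

lemma exists_singleton {C Q : List V} {d : ℕ} (h : IsCyclePathCover G C Q)
    (hG : ∀ l, ¬ IsHamiltonianList G l)
    (hd : ∀ v, d ≤ #{w | G.Adj v w}) (hQ : 2 * d + Q.length ≤ Fintype.card V)
    (h3 : Fintype.card V + 1 < 3 * d) (h10 : 4 * Fintype.card V < 10 * d + 4) :
    ∃ C w, IsCyclePathCover G C [w] := by
  classical
  have hex : ∃ q C Q, IsCyclePathCover G C Q ∧ Q.length = q := ⟨_, C, Q, h, rfl⟩
  obtain ⟨C', Q', h', hq⟩ := Nat.find_spec hex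
  have hmin : ∀ C Q, IsCyclePathCover G C Q → Q'.length ≤ Q.length := fun C Q h =>
    hq ▸ Nat.find_min' hex ⟨C, Q, h, rfl⟩
  have := h'.length_eq_one_of_minimal hG hmin hd (by have := hmin _ _ h; omega) h3 h10
  obtain ⟨w, rfl⟩ := List.length_eq_one_iff.1 this
  exact ⟨C', w, h'⟩

end Count

end IsCyclePathCover

lemma List.IsChain.reverse_of_symm {α : Type*} {T : α → α → Prop} (hT : ∀ u v, T u v → T v u)
    {l : List α} (h : l.IsChain T) : l.reverse.IsChain T :=
  List.isChain_reverse.2 (h.imp fun _ _ => hT _ _)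

/-- Reversing the initial segment of a list that precedes `y`. -/
lemma List.IsChain.exists_reverse_initial {α : Type*} {T U : α → α → Prop} {l : List α} {x y : α}
    (h : l.IsChain U) (hUT : ∀ u v, U u v → T u v ∧ T v u) (hx : l.head? = some x) (hy : y ∈ l)
    (hne : x ≠ y) (hxy : T x y) :
    ∃ (l' : List α) (c : α), l'.Perm l ∧ l'.IsChain T ∧ l'.head? = some c ∧ U c y ∧
      l'.getLast? = l.getLast? := by
  obtain ⟨s, q, rfl⟩ := List.append_of_mem hy
  rcases List.eq_nil_or_concat s with rfl | ⟨p, c, rfl⟩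
  · simp at hx; exact absurd hx.symm hne
  rw [List.concat_eq_append] at *
  rw [List.head?_append_of_ne_nil _ (by simp)] at hx
  have h' : (p ++ c :: y :: q).IsChain U := by simpa using h
  refine ⟨(p ++ [c]).reverse ++ y :: q, c, List.Perm.append_right _ (List.reverse_perm _), ?_,
    by simp, (List.isChain_append_cons_cons.1 h').2.1,
    by rw [List.getLast?_append_cons, List.getLast?_append_cons]⟩
  rw [List.isChain_append] at h
  refine List.isChain_append.2 ⟨List.isChain_reverse.2 (h.1.imp fun u v huv => (hUT _ _ huv).2),
    h.2.1.imp fun u v huv => (hUT _ _ huv).1, ?_⟩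
  intro a ha b hb
  rw [List.getLast?_reverse, hx] at ha
  cases ha; cases hb
  exact hxy

/-- The permutation `σ` fixes `w` and is a Hamiltonian cycle of `G - w`. -/
structure IsCycleAvoiding {V : Type*} (G : SimpleGraph V) (σ : Equiv.Perm V) (w : V) : Prop where
  apply_self : σ w = w
  exists_list : ∀ x ≠ w, ∃ t : List V, (t ++ [x]).Nodup ∧ (∀ z, z ∈ t ++ [x] ↔ z ≠ w) ∧
    (t ++ [x]).IsChain (fun u v => σ u = v ∧ G.Adj u v) ∧ (t ++ [x]).head? = some (σ x)

lemma IsCyclePathCover.isCycleAvoiding {V : Type*} [DecidableEq V] {G : SimpleGraph V} {C : List V}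
    {w : V} (h : IsCyclePathCover G C [w]) (hC : 4 ≤ C.length) :
    IsCycleAvoiding G C.formPerm w where
  apply_self := by
    refine List.formPerm_apply_of_notMem fun hw => ?_
    exact List.disjoint_of_nodup_append h.nodup hw (by simp)
  exists_list := by
    intro x hx
    have hmem : ∀ z, z ∈ C ↔ z ≠ w := by
      intro z
      refine ⟨?_, fun hz => ?_⟩
      · rintro hz rfl
        exact List.disjoint_of_nodup_append h.nodup hz (by simp)
      · have := h.mem z
        simpa [hz] using this
    obtain ⟨s, r, rfl⟩ := List.append_of_mem ((hmem x).2 hx)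
    have hperm : (s ++ x :: r).Perm (r ++ s ++ [x]) := by
      have h1 : (x :: (s ++ r)).Perm (x :: (r ++ s)) := List.perm_append_comm.cons x
      exact List.perm_middle.trans (h1.trans (List.perm_append_singleton _ _).symm)
    have hrot : (s ++ x :: r).IsRotated (r ++ s ++ [x]) :=
      ⟨s.length + 1, by
        rw [show s ++ x :: r = (s ++ [x]) ++ r by simp,
          show s.length + 1 = (s ++ [x]).length by simp, List.rotate_append_length_eq]
        simp⟩
    have hnd : (s ++ x :: r).Nodup := (List.nodup_append.1 h.nodup).1
    have hnd' := hperm.nodup_iff.1 hnd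
    have hσ := List.formPerm_eq_of_isRotated hnd hrot
    have hchain : (r ++ s ++ [x]).IsChain G.Adj := by
      have h1 : IsCyclePathCover G ((s ++ [x]) ++ r) [w] := by simpa using h
      have h2 := h1.rotate.isChain_cycle
      exact h2.of_eq_append (p := []) (q := r ++ s ++ [x]) (by simp)
    refine ⟨r ++ s, hnd', fun z => by rw [← hmem z, hperm.mem_iff], ?_, ?_⟩
    · rw [hσ, List.isChain_iff_forall_rel_of_append_cons_cons]
      intro a b l₁ l₂ hl
      refine ⟨hnd'.formPerm_apply_of_eq_append hl, ?_⟩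
      rw [hl] at hchain
      exact (List.isChain_append_cons_cons.1 hchain).2.1
    · rw [hσ]
      rcases hrs : r ++ s with _ | ⟨c, t⟩
      · have : (s ++ x :: r).length = (r ++ s).length + 1 := by
          simp only [List.length_append, List.length_cons]; omega
        rw [this, hrs] at hC
        simp at hC
      · simp

namespace IsCycleAvoiding

variable {V : Type*} {G : SimpleGraph V} {σ : Equiv.Perm V} {w : V}

lemma exists_lists (h : IsCycleAvoiding G σ w) {x y : V} (hx : x ≠ w) (hy : y ≠ w) (hxy : x ≠ y) :
    ∃ p q : List V, (p ++ q).Nodup ∧ (∀ z, z ∈ p ++ q ↔ z ≠ w) ∧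
      p.IsChain (fun u v => σ u = v ∧ G.Adj u v) ∧ q.IsChain (fun u v => σ u = v ∧ G.Adj u v) ∧
      p.head? = some (σ x) ∧ p.getLast? = some y ∧ q.head? = some (σ y) ∧ q.getLast? = some x := by
  obtain ⟨t, hnd, hmem, hch, hhead⟩ := h.exists_list x hx
  have hyt : y ∈ t := by
    have := (hmem y).2 hy
    simpa [hxy.symm] using this
  obtain ⟨s, r, rfl⟩ := List.append_of_mem hyt
  have he : s ++ y :: r ++ [x] = (s ++ [y]) ++ (r ++ [x]) := by simp
  rw [he] at hnd hch hhead
  simp only [he] at hmem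
  rw [List.head?_append_of_ne_nil _ (by simp)] at hhead
  rw [List.isChain_append] at hch
  refine ⟨s ++ [y], r ++ [x], hnd, hmem, hch.1, hch.2.1, hhead, by simp, ?_, by simp⟩
  obtain ⟨c, r', hc⟩ : ∃ c r', r ++ [x] = c :: r' := List.exists_cons_of_ne_nil (by simp)
  have := (hch.2.2 y (by simp) c (by simp [hc])).1
  rw [hc, this]; rfl

variable {T : V → V → Prop}

lemma exists_list_of_rel (h : IsCycleAvoiding G σ w) (hT : ∀ u v, T u v → T v u)
    (hσ : ∀ u, G.Adj u (σ u) → T u (σ u)) {x y : V} (hx : x ≠ w) (hy : y ≠ w) (hxy : x ≠ y)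
    (hTxy : T x y) :
    ∃ l : List V, l.Nodup ∧ (∀ z, z ∈ l ↔ z ≠ w) ∧ l.IsChain T ∧ l.head? = some (σ x) ∧
      l.getLast? = some (σ y) := by
  obtain ⟨p, q, hnd, hmem, hp, hq, hp1, hp2, hq1, hq2⟩ := h.exists_lists hx hy hxy
  have hperm : (p ++ q).Perm (p ++ q.reverse) := List.Perm.append_left _ (List.reverse_perm _).symm
  have himp : ∀ u v, (σ u = v ∧ G.Adj u v) → T u v := by
    rintro u v ⟨rfl, h⟩; exact hσ _ h
  refine ⟨p ++ q.reverse, hperm.nodup_iff.1 hnd, fun z => by rw [← hmem z, hperm.mem_iff], ?_, ?_,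
    ?_⟩
  · refine (hp.imp himp).append ((hq.imp himp).reverse_of_symm hT) ?_
    intro a ha b hb
    rw [hp2] at ha
    rw [List.head?_reverse, hq2] at hb
    cases ha; cases hb
    exact hT _ _ hTxy
  · rw [List.head?_append, hp1]; rfl
  · rw [List.getLast?_append, List.getLast?_reverse, hq1]; rfl

lemma exists_list_of_rel_apply (h : IsCycleAvoiding G σ w) (hT : ∀ u v, T u v → T v u)
    (hσ : ∀ u, G.Adj u (σ u) → T u (σ u)) {x y : V} (hx : x ≠ w) (hy : y ≠ w) (hxy : x ≠ y)
    (hTxy : T (σ x) (σ y)) :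
    ∃ l : List V, l.Nodup ∧ (∀ z, z ∈ l ↔ z ≠ w) ∧ l.IsChain T ∧ l.head? = some x ∧
      l.getLast? = some y := by
  obtain ⟨p, q, hnd, hmem, hp, hq, hp1, hp2, hq1, hq2⟩ := h.exists_lists hx hy hxy
  have hperm : (p ++ q).Perm (q.reverse ++ p) :=
    List.perm_append_comm.trans (List.Perm.append_right _ (List.reverse_perm _).symm)
  have himp : ∀ u v, (σ u = v ∧ G.Adj u v) → T u v := by
    rintro u v ⟨rfl, h⟩; exact hσ _ h
  refine ⟨q.reverse ++ p, hperm.nodup_iff.1 hnd, fun z => by rw [← hmem z, hperm.mem_iff], ?_, ?_,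
    ?_⟩
  · refine ((hq.imp himp).reverse_of_symm hT).append (hp.imp himp) ?_
    intro a ha b hb
    rw [hp1] at hb
    rw [List.getLast?_reverse, hq1] at ha
    cases ha; cases hb
    exact hT _ _ hTxy
  · rw [List.head?_append, List.head?_reverse, hq2]; rfl
  · rw [List.getLast?_append, hp2]; rfl

end IsCycleAvoiding

section Hopping

variable {V : Type*} (G : SimpleGraph V) (σ : Equiv.Perm V) (w : V)

/-- The vertices both of whose neighbours on the cycle `σ` belong to `X`. -/
def hopInner (X : Set V) : Set V := {y | σ y ∈ X ∧ σ.symm y ∈ X}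

/-- The sets of Woodall's hopping lemma. -/
def hopSet : ℕ → Set V
  | 0 => {x | G.Adj w x}
  | a + 1 => {x | G.Adj w x ∨ ∃ y ∈ hopInner σ (hopSet a), G.Adj x y}

/-- The edge `uv` respects the first `a` hopping sets. -/
def HopRel (a : ℕ) (u v : V) : Prop :=
  ∀ b < a, (u ∈ hopInner σ (hopSet G σ w b) → v ∈ hopSet G σ w b) ∧
    (v ∈ hopInner σ (hopSet G σ w b) → u ∈ hopSet G σ w b)

variable {G σ w}

lemma HopRel.symm {a : ℕ} {u v : V} (h : HopRel G σ w a u v) : HopRel G σ w a v u :=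
  fun b hb => (h b hb).symm

lemma hopRel_apply (a : ℕ) (u : V) : HopRel G σ w a u (σ u) :=
  fun b _ => ⟨fun h => h.1, fun h => by simpa using h.2⟩

lemma hopRel_of_notMem {a : ℕ} {u v : V} (hu : ∀ b < a, u ∉ hopInner σ (hopSet G σ w b))
    (hv : ∀ b < a, v ∉ hopInner σ (hopSet G σ w b)) : HopRel G σ w a u v :=
  fun b hb => ⟨fun h => absurd h (hu b hb), fun h => absurd h (hv b hb)⟩

lemma hopInner_mono : Monotone (hopInner σ) := fun _ _ h _ hx => ⟨h hx.1, h hx.2⟩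

lemma hopSet_monotone : Monotone (hopSet G σ w) := by
  refine monotone_nat_of_le_succ fun a => ?_
  induction a with
  | zero => exact fun x hx => Or.inl hx
  | succ a ih =>
    rintro x (hx | ⟨y, hy, hxy⟩)
    · exact Or.inl hx
    · exact Or.inr ⟨y, hopInner_mono ih hy, hxy⟩

lemma adj_mem_hopSet {x : V} (a : ℕ) (h : G.Adj w x) : x ∈ hopSet G σ w a :=
  hopSet_monotone (Nat.zero_le a) h

lemma mem_hopSet_of_adj {x y : V} {a b : ℕ} (hab : b < a) (hy : y ∈ hopInner σ (hopSet G σ w b))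
    (h : G.Adj x y) : x ∈ hopSet G σ w a :=
  hopSet_monotone hab (Or.inr ⟨y, hy, h⟩)

/-- No Hamiltonian path of `G - w` that respects the first `a` hopping sets
has both its ends in the next one. -/
def NoHopPath (G : SimpleGraph V) (σ : Equiv.Perm V) (w : V) (a : ℕ) : Prop :=
  ∀ (l : List V) (x y : V), l.Nodup → (∀ z, z ∈ l ↔ z ≠ w) → l.IsChain G.Adj →
    l.IsChain (HopRel G σ w a) → l.head? = some x → l.getLast? = some y →
    x ∈ hopSet G σ w a → y ∉ hopSet G σ w a

lemma noHopPath_zero (hG : ∀ l, ¬ IsHamiltonianList G l) : NoHopPath G σ w 0 := by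
  intro l x y hnd hmem hch _ hx hy hxX hyX
  refine hG (w :: l) ⟨List.nodup_cons.2 ⟨fun h => (hmem w).1 h rfl, hnd⟩, ?_, ?_⟩
  · intro z
    by_cases hz : z = w
    · simp [hz]
    · simp [hmem, hz]
  · refine List.isChain_append_self (List.isChain_cons.2 ⟨?_, hch⟩) ?_
    · intro z hz
      rw [hx] at hz; cases hz; exact hxX
    · intro z hz z' hz'
      rw [List.getLast?_cons, hy] at hz
      cases hz; cases hz'
      exact hyX.symm

lemma notMem_hopSet_apply (h : IsCycleAvoiding G σ w) {a : ℕ} (hno : NoHopPath G σ w a)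
    (hw : w ∉ hopSet G σ w a) {x : V} (hx : x ∈ hopSet G σ w a) : σ x ∉ hopSet G σ w a := by
  have hxw : x ≠ w := by rintro rfl; exact hw hx
  obtain ⟨t, hnd, hmem, hch, hhead⟩ := h.exists_list x hxw
  intro hσ
  refine hno _ _ _ hnd hmem (hch.imp fun _ _ h => h.2) (hch.imp ?_) hhead
    (by simp) hσ hx
  rintro u v ⟨rfl, -⟩
  exact hopRel_apply _ _

section

variable {a : ℕ} (h : IsCycleAvoiding G σ w) (hno : NoHopPath G σ w a)
  (hw : w ∉ hopSet G σ w a)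

include h hno hw

lemma notMem_hopInner {x : V} (hx : x ∈ hopSet G σ w a) : x ∉ hopInner σ (hopSet G σ w a) :=
  fun hx' => notMem_hopSet_apply h hno hw hx hx'.1

lemma ne_of_mem_hopInner {x : V} (hx : x ∈ hopInner σ (hopSet G σ w a)) : x ≠ w := by
  rintro rfl
  exact hw (by simpa [h.apply_self] using hx.1)

lemma notMem_hopInner_of_adj {x y : V} (hy : y ∈ hopInner σ (hopSet G σ w a)) (hxy : G.Adj x y)
    {b : ℕ} (hb : b < a) : x ∉ hopInner σ (hopSet G σ w b) :=
  fun hx => notMem_hopInner h hno hw (mem_hopSet_of_adj hb hx hxy.symm) hy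

/-- The hopping set of index `a + 1` does not meet the inner vertices of the previous one. -/
lemma notMem_hopInner_of_mem_succ {x : V} (hx : x ∈ hopSet G σ w (a + 1)) :
    x ∉ hopInner σ (hopSet G σ w a) := by
  intro hx'
  rcases hx with hx | ⟨y, hy, hxy⟩
  · exact notMem_hopInner h hno hw (adj_mem_hopSet a hx) hx'
  obtain ⟨l, hnd, hmem, hch, hhead, hlast⟩ := h.exists_list_of_rel
    (T := fun u v => G.Adj u v ∧ HopRel G σ w a u v)
    (fun u v h => ⟨h.1.symm, h.2.symm⟩) (fun u hu => ⟨hu, hopRel_apply _ _⟩)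
    (ne_of_mem_hopInner h hno hw hx') (ne_of_mem_hopInner h hno hw hy) hxy.ne
    ⟨hxy, hopRel_of_notMem (fun b hb => notMem_hopInner_of_adj h hno hw hy hxy hb)
      (fun b hb => notMem_hopInner_of_adj h hno hw hx' hxy.symm hb)⟩
  exact hno l _ _ hnd hmem (hch.imp fun _ _ h => h.1) (hch.imp fun _ _ h => h.2) hhead hlast
    hx'.1 hy.1

lemma hopRel_of_adj {x y : V} (hx : x ∈ hopSet G σ w (a + 1))
    (hxa : x ∉ hopSet G σ w a) (hxy : G.Adj x y) : HopRel G σ w a x y :=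
  hopRel_of_notMem
    (fun _ hb hx' => notMem_hopInner_of_mem_succ h hno hw hx
      (hopInner_mono (hopSet_monotone hb.le) hx'))
    (fun _ hb hy => hxa (mem_hopSet_of_adj hb hy hxy))

lemma noHopPath_succ : NoHopPath G σ w (a + 1) := by
  intro l x z hnd hmem hch hrel hx hz hxX hzX
  set X := hopSet G σ w a with hX
  set Y := hopInner σ X with hY
  have hU : l.IsChain (fun u v => (G.Adj u v ∧ HopRel G σ w a u v) ∧
      (u ∈ Y → v ∈ X) ∧ (v ∈ Y → u ∈ X)) := by
    rw [List.isChain_iff_forall_rel_of_append_cons_cons] at hch hrel ⊢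
    intro u v l₁ l₂ hl
    exact ⟨⟨hch hl, fun b hb => hrel hl b (hb.trans (Nat.lt_succ_self a))⟩,
      hrel hl a (Nat.lt_succ_self a)⟩
  obtain ⟨l₁, c, hp₁, hch₁, hhead₁, hcX, hlast₁⟩ : ∃ (l' : List V) (c : V), l'.Perm l ∧
      l'.IsChain (fun u v => (G.Adj u v ∧ HopRel G σ w a u v) ∧ (u ∈ Y → v ∈ X)) ∧
      l'.head? = some c ∧ c ∈ X ∧ l'.getLast? = l.getLast? := by
    by_cases hxa : x ∈ X
    · exact ⟨l, x, List.Perm.refl _, hU.imp fun _ _ h => ⟨h.1, h.2.1⟩, hx, hxa, rfl⟩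
    rcases hxX with hxw | ⟨y, hy, hxy⟩
    · exact absurd (adj_mem_hopSet a hxw) hxa
    have hxX : x ∈ hopSet G σ w (a + 1) := Or.inr ⟨y, hy, hxy⟩
    obtain ⟨l', c, h1, h2, h3, h4, h5⟩ := hU.exists_reverse_initial
      (T := fun u v => (G.Adj u v ∧ HopRel G σ w a u v) ∧ (u ∈ Y → v ∈ X))
      (fun u v h => ⟨⟨h.1, h.2.1⟩, ⟨h.1.1.symm, h.1.2.symm⟩, h.2.2⟩) hx
      ((hmem y).2 (ne_of_mem_hopInner h hno hw hy)) hxy.ne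
      ⟨⟨hxy, hopRel_of_adj h hno hw hxX hxa hxy⟩,
        fun hx => absurd hx (notMem_hopInner_of_mem_succ h hno hw hxX)⟩
    exact ⟨l', c, h1, h2, h3, h4.2.2 hy, h5⟩
  rw [hz] at hlast₁
  have hrev : l₁.reverse.IsChain
      (fun u v => (G.Adj u v ∧ HopRel G σ w a u v) ∧ (v ∈ Y → u ∈ X)) :=
    List.isChain_reverse.2 (hch₁.imp fun u v h => ⟨⟨h.1.1.symm, h.1.2.symm⟩, h.2⟩)
  have hheadr : l₁.reverse.head? = some z := by rw [List.head?_reverse, hlast₁]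
  have hlastr : l₁.reverse.getLast? = some c := by rw [List.getLast?_reverse, hhead₁]
  have hpr : l₁.reverse.Perm l := (List.reverse_perm _).trans hp₁
  obtain ⟨l₂, e, hp₂, hch₂, hhead₂, heX, hlast₂⟩ : ∃ (l' : List V) (e : V), l'.Perm l ∧
      l'.IsChain (fun u v => G.Adj u v ∧ HopRel G σ w a u v) ∧
      l'.head? = some e ∧ e ∈ X ∧ l'.getLast? = some c := by
    by_cases hza : z ∈ X
    · exact ⟨_, z, hpr, hrev.imp fun _ _ h => h.1, hheadr, hza, hlastr⟩
    rcases hzX with hzw | ⟨y, hy, hzy⟩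
    · exact absurd (adj_mem_hopSet a hzw) hza
    have hzX : z ∈ hopSet G σ w (a + 1) := Or.inr ⟨y, hy, hzy⟩
    obtain ⟨l', e, h1, h2, h3, h4, h5⟩ := hrev.exists_reverse_initial
      (T := fun u v => G.Adj u v ∧ HopRel G σ w a u v)
      (fun u v h => ⟨h.1, h.1.1.symm, h.1.2.symm⟩) hheadr
      (hpr.mem_iff.2 ((hmem y).2 (ne_of_mem_hopInner h hno hw hy))) hzy.ne
      ⟨hzy, hopRel_of_adj h hno hw hzX hza hzy⟩
    exact ⟨l', e, h1.trans hpr, h2, h3, h4.2 hy, h5.trans hlastr⟩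
  exact hno l₂ e c (hp₂.nodup_iff.2 hnd) (fun z => by rw [← hmem z, hp₂.mem_iff])
    (hch₂.imp fun _ _ h => h.1) (hch₂.imp fun _ _ h => h.2) hhead₂ hlast₂ heX hcX

lemma notMem_hopSet_succ : w ∉ hopSet G σ w (a + 1) := by
  rintro (hww | ⟨y, hy, hwy⟩)
  · exact G.irrefl hww
  · exact notMem_hopSet_apply h hno hw (adj_mem_hopSet a hwy) hy.1

end

/-- **Hopping lemma**: if `σ` is a Hamiltonian cycle of `G - w` and `G` is not Hamiltonian then
some set `X` containing the neighbours of `w` contains all the neighbours of the vertices that lie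
between two members of `X` on the cycle, while `X` contains no two consecutive vertices, and the
successors as well as the predecessors of the vertices of `X` are independent. -/
theorem IsCycleAvoiding.exists_hopping_set [Finite V] (h : IsCycleAvoiding G σ w)
    (hG : ∀ l, ¬ IsHamiltonianList G l) :
    ∃ X : Set V, (∀ x, G.Adj w x → x ∈ X) ∧ w ∉ X ∧ (∀ x ∈ X, σ x ∉ X) ∧
      (∀ y, σ y ∈ X → σ.symm y ∈ X → ∀ z, G.Adj y z → z ∈ X) ∧
      (∀ x ∈ X, ∀ y ∈ X, ¬ G.Adj (σ x) (σ y)) ∧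
      (∀ x ∈ X, ∀ y ∈ X, ¬ G.Adj (σ.symm x) (σ.symm y)) := by
  have key : ∀ a, NoHopPath G σ w a ∧ w ∉ hopSet G σ w a := by
    intro a
    induction a with
    | zero => exact ⟨noHopPath_zero hG, G.irrefl⟩
    | succ a ih => exact ⟨noHopPath_succ h ih.1 ih.2, notMem_hopSet_succ h ih.1 ih.2⟩
  obtain ⟨a, ha⟩ := WellFoundedGT.monotone_chain_condition ⟨hopSet G σ w, hopSet_monotone⟩
  have ha' : hopSet G σ w a = hopSet G σ w (a + 1) := ha (a + 1) (Nat.le_succ a)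
  obtain ⟨hno, hw⟩ := key a
  have hσ := fun x => notMem_hopSet_apply (x := x) h hno hw
  have hne : ∀ {x}, x ∈ hopSet G σ w a → x ≠ w := by
    rintro x hx rfl; exact hw hx
  refine ⟨hopSet G σ w a, fun x => adj_mem_hopSet a, hw, hσ, ?_, ?_, ?_⟩
  · intro y h1 h2 z hyz
    rw [ha']
    exact Or.inr ⟨y, ⟨h1, h2⟩, hyz.symm⟩
  · intro x hx y hy hxy
    obtain ⟨l, hnd, hmem, hch, hhead, hlast⟩ := h.exists_list_of_rel_apply
      (T := fun u v => G.Adj u v ∧ HopRel G σ w a u v)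
      (fun u v h => ⟨h.1.symm, h.2.symm⟩) (fun u hu => ⟨hu, hopRel_apply _ _⟩)
      (hne hx) (hne hy) (by rintro rfl; exact G.irrefl hxy)
      ⟨hxy, hopRel_of_notMem (fun b hb hb' => hσ y hy (mem_hopSet_of_adj hb hb' hxy.symm))
        (fun b hb hb' => hσ x hx (mem_hopSet_of_adj hb hb' hxy))⟩
    exact hno l _ _ hnd hmem (hch.imp fun _ _ h => h.1) (hch.imp fun _ _ h => h.2) hhead hlast
      hx hy
  · intro x hx y hy hxy
    have hs : ∀ {x}, x ≠ w → σ.symm x ≠ w := by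
      intro x hx hx'
      rw [Equiv.symm_apply_eq, h.apply_self] at hx'
      exact hx hx'
    have hs' : ∀ x ∈ hopSet G σ w a, σ.symm x ∉ hopSet G σ w a :=
      fun x hx hx' => hσ _ hx' (by simpa using hx)
    obtain ⟨l, hnd, hmem, hch, hhead, hlast⟩ := h.exists_list_of_rel
      (T := fun u v => G.Adj u v ∧ HopRel G σ w a u v)
      (fun u v h => ⟨h.1.symm, h.2.symm⟩) (fun u hu => ⟨hu, hopRel_apply _ _⟩)
      (hs (hne hx)) (hs (hne hy)) hxy.ne
      ⟨hxy, hopRel_of_notMem (fun b hb hb' => hs' y hy (mem_hopSet_of_adj hb hb' hxy.symm))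
        (fun b hb hb' => hs' x hx (mem_hopSet_of_adj hb hb' hxy))⟩
    rw [Equiv.apply_symm_apply] at hhead hlast
    exact hno l _ _ hnd hmem (hch.imp fun _ _ h => h.1) (hch.imp fun _ _ h => h.2) hhead hlast
      hx hy

end Hopping

section Count

variable {V : Type*} [Fintype V] [DecidableEq V] {G : SimpleGraph V} [DecidableRel G.Adj]

lemma le_card_of_disjoint_neighbors {d : ℕ} {v : V} {s : Finset V} (hd : d ≤ #{u | G.Adj v u})
    (hs : ∀ u ∈ s, ¬ G.Adj v u) : d + #s ≤ Fintype.card V := by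
  have h1 : Disjoint (univ.filter (G.Adj v)) s := by
    rw [Finset.disjoint_left]
    intro u hu hus
    exact hs u hus (by simpa using hu)
  have h2 := Finset.card_le_univ (univ.filter (G.Adj v) ∪ s)
  rw [card_union_of_disjoint h1] at h2
  exact (Nat.add_le_add_right hd _).trans h2

/-- The numerical contradiction between the minimum degree of a balanced multipartite graph
and a hopping set. -/
lemma false_of_hopping_set {k m d : ℕ} {P : V → Fin k} (hP : ∀ i, #{v | P v = i} = m)
    (hGP : ∀ u v, G.Adj u v → P u ≠ P v) (hd : ∀ v, d ≤ #{u | G.Adj v u})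
    (hn : Fintype.card V = k * m)
    (hc : (k / 2 + 2) * (k * m) + 3 ≤ 2 * (k / 2 + 1) * (d + m))
    (h1 : k * m + 2 ≤ 2 * d + m) (h6 : k ≠ 4 → 2 * (k * m) < 4 * d + m + 2)
    (h4 : k = 4 → 5 * m + 2 ≤ 3 * d)
    {σ : Equiv.Perm V} {w : V} {X : Finset V} (hσw : σ w = w) (hXw : ∀ x, G.Adj w x → x ∈ X)
    (hw : w ∉ X) (hX : ∀ x ∈ X, σ x ∉ X)
    (hY : ∀ y, σ y ∈ X → σ.symm y ∈ X → ∀ z, G.Adj y z → z ∈ X)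
    (hS : ∀ x ∈ X, ∀ y ∈ X, ¬ G.Adj (σ x) (σ y))
    (hR : ∀ x ∈ X, ∀ y ∈ X, ¬ G.Adj (σ.symm x) (σ.symm y)) : False := by
  set S := X.map σ.toEmbedding with hSdef
  set R := X.map σ.symm.toEmbedding with hRdef
  have memS : ∀ v, v ∈ S ↔ σ.symm v ∈ X := fun v => Finset.mem_map_equiv
  have memR : ∀ v, v ∈ R ↔ σ v ∈ X := fun v => by
    rw [hRdef, Finset.mem_map_equiv, Equiv.symm_symm]
  have hσw' : σ.symm w = w := by rw [Equiv.symm_apply_eq, hσw]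
  have hwS : w ∉ S := by rwa [memS, hσw']
  have hwR : w ∉ R := by rwa [memR, hσw]
  have hXS : ∀ v ∈ S, v ∉ X := fun v hv hvX => by
    have := hX _ ((memS v).1 hv)
    rw [Equiv.apply_symm_apply] at this
    exact this hvX
  have hXR : ∀ v ∈ R, v ∉ X := fun v hv hvX => hX v hvX ((memR v).1 hv)
  have hSc : #S = #X := card_map _
  have hRc : #R = #X := card_map _
  set Y := insert w (S ∩ R) with hYdef
  have hYc : #Y = #(S ∩ R) + 1 := card_insert_of_notMem fun h => hwS (mem_inter.1 h).1
  have hYN : ∀ y ∈ Y, ∀ z, G.Adj y z → z ∈ X := by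
    intro y hy z hyz
    rw [hYdef, mem_insert, mem_inter] at hy
    rcases hy with rfl | ⟨h1, h2⟩
    · exact hXw z hyz
    · exact hY y ((memR y).1 h2) ((memS y).1 h1) z hyz
  have hdX : ∀ y ∈ Y, d + #{v ∈ X | P v = P y} ≤ #X := by
    intro y hy
    have h1 : univ.filter (G.Adj y) ⊆ {v ∈ X | ¬ P v = P y} := by
      intro z hz
      simp only [mem_filter, mem_univ, true_and] at hz ⊢
      exact ⟨hYN y hy z hz, (hGP _ _ hz).symm⟩
    have h2 := card_le_card h1
    have h3 := card_filter_add_card_filter_not (s := X) (fun v => P v = P y)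
    have h4 : d ≤ #(univ.filter (G.Adj y)) := hd y
    omega
  have hdx : d ≤ #X := by
    have := hdX w (mem_insert_self _ _); omega
  have hSR : #(S ∪ R) + #(S ∩ R) = 2 * #X := by
    rw [card_union_add_card_inter, hSc, hRc, two_mul]
  have hSRX : #(S ∪ R) + #X + 1 ≤ k * m := by
    have hdis : Disjoint (S ∪ R) X := by
      rw [Finset.disjoint_left]
      intro v hv
      rcases mem_union.1 hv with h | h
      · exact hXS v h
      · exact hXR v h
    rw [← hn, ← card_union_of_disjoint hdis]
    refine card_lt_univ_of_notMem (x := w) ?_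
    simp [hwS, hwR, hw]
  have hx2 : 2 * #X + 1 ≤ k * m := by
    have : #S ≤ #(S ∪ R) := card_le_card subset_union_left
    omega
  set T := Y.image P with hT
  have hTX : ∀ i ∈ T, d + #{v ∈ X | P v = i} ≤ #X := by
    intro i hi
    obtain ⟨y, hy, rfl⟩ := mem_image.1 hi
    exact hdX y hy
  have hPX : ∀ i, #{v ∈ X | P v = i} ≤ m := fun i =>
    (card_le_card (filter_subset_filter _ (subset_univ X))).trans (hP i).le
  have hTk : #T ≤ k := by simpa using card_le_univ T
  have hXsum : #X = ∑ i ∈ T, #{v ∈ X | P v = i} + ∑ i ∈ Tᶜ, #{v ∈ X | P v = i} := by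
    rw [sum_add_sum_compl]
    exact card_eq_sum_card_fiberwise fun _ _ => mem_univ _
  have hTsum : #T * d + ∑ i ∈ T, #{v ∈ X | P v = i} ≤ #T * #X := by
    rw [← smul_eq_mul, ← sum_const, ← sum_add_distrib, ← smul_eq_mul (#T), ← sum_const]
    exact sum_le_sum hTX
  have hTcsum : ∑ i ∈ Tᶜ, #{v ∈ X | P v = i} + #T * m ≤ k * m := by
    have h1 := sum_le_card_nsmul Tᶜ _ m fun i _ => hPX i
    rw [card_compl, Fintype.card_fin, smul_eq_mul] at h1
    calc _ ≤ (k - #T) * m + #T * m := Nat.add_le_add_right h1 _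
      _ = k * m := by rw [← add_mul, Nat.sub_add_cancel hTk]
  rcases Nat.lt_or_ge (k / 2) (#T) with ht | ht
  · have h2 : #X ≤ d + m := by omega
    have h3 : #X + #T * (d + m) ≤ #T * #X + k * m := by
      rw [mul_add]; omega
    obtain ⟨e, he⟩ := Nat.exists_eq_add_of_le h2
    obtain ⟨f, hf⟩ := Nat.exists_eq_add_of_lt ht
    rw [he] at h3
    have h4 : (k / 2 + 1) * e ≤ #T * e := Nat.mul_le_mul_right _ ht
    have h5 : #X + (k / 2 + 1) * e ≤ k * m := by
      have : #T * (#X + e) = #T * #X + #T * e := mul_add _ _ _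
      omega
    rw [he] at hc
    have h6 : k / 2 * (2 * #X + 1) ≤ k / 2 * (k * m) := Nat.mul_le_mul_left _ hx2
    generalize k * m = n at *
    generalize k / 2 = c at *
    nlinarith
  set U : Finset V := univ.filter fun v => P v ∈ T with hU
  have hUc : #U = #T * m := by
    rw [hU, card_eq_sum_card_fiberwise (f := P) (t := T) (by intro v hv; simpa using hv),
      ← smul_eq_mul, ← sum_const]
    refine sum_congr rfl fun i hi => ?_
    rw [← hP i, filter_filter]
    congr 1
    ext v
    simp only [mem_filter, mem_univ, true_and]
    exact ⟨fun h => h.2, fun h => ⟨h ▸ hi, h⟩⟩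
  obtain ⟨z, hz⟩ : ∃ z, z ∉ X ∪ U := by
    by_contra! hcon
    have h2 : #(X ∪ U) = k * m := by rw [← hn, ← card_univ, eq_univ_of_forall hcon]
    have h3 := card_union_le X U
    have h5 : 2 * #T * m ≤ k * m := Nat.mul_le_mul_right _ (by omega)
    rw [mul_assoc] at h5
    omega
  simp only [mem_union, hU, mem_filter, mem_univ, true_and, not_or] at hz
  have hyd : #Y + m + d ≤ k * m := by
    have hdis : Disjoint Y (univ.filter fun v => P v = P z) := by
      rw [Finset.disjoint_left]
      intro y hy hyz
      simp only [mem_filter, mem_univ, true_and] at hyz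
      exact hz.2 (hyz ▸ mem_image_of_mem P hy)
    have := le_card_of_disjoint_neighbors (hd z) (s := Y ∪ univ.filter fun v => P v = P z) (by
      intro u hu hzu
      simp only [mem_union, mem_filter, mem_univ, true_and] at hu
      rcases hu with hu | hu
      · exact hz.1 (hYN u hu z hzu.symm)
      · exact hGP _ _ hzu hu.symm)
    rw [card_union_of_disjoint hdis, hP, hn] at this
    omega
  rcases ne_or_eq k 4 with hk | rfl
  · have := h6 hk
    omega
  have h4' := h4 rfl
  have hYU : Y ⊆ U := fun y hy => by
    simp only [hU, mem_filter, mem_univ, true_and]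
    exact mem_image_of_mem P hy
  have hYU' := card_le_card hYU
  rw [hUc] at hYU'
  have ht2 : #T = 2 := by
    by_contra hne
    have : #T ≤ 1 := by omega
    have : #T * m ≤ 1 * m := Nat.mul_le_mul_right _ this
    omega
  rw [ht2] at hUc hTsum
  have hind : ∀ I : Finset V, #I = #X + 1 → (∀ u ∈ I, ∀ v ∈ I, ¬ G.Adj u v) → Disjoint I X →
      I ⊆ U := by
    intro I hI hIG hIX v hv
    by_contra hvU
    have hvT : P v ∈ Tᶜ := by simpa [hU] using hvU
    have h2 := le_card_of_disjoint_neighbors (hd v) (s := I ∪ univ.filter fun u => P u = P v) (by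
      intro u hu huv
      simp only [mem_union, mem_filter, mem_univ, true_and] at hu
      rcases hu with hu | hu
      · exact hIG v hv u hu huv
      · exact hGP _ _ huv hu.symm)
    have h3 := card_union_add_card_inter I (univ.filter fun u => P u = P v)
    rw [hP] at h3
    have h5 : ∑ i ∈ Tᶜ, #{u ∈ X | P u = i} ≤ m + #{u ∈ X | P u = P v} := by
      rw [← add_sum_erase _ _ hvT, add_comm m]
      have h6 := sum_le_card_nsmul (Tᶜ.erase (P v)) _ m fun i _ => hPX i
      rw [card_erase_of_mem hvT, card_compl, Fintype.card_fin, ht2] at h6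
      simpa using h6
    have h7 : #(I ∩ univ.filter fun u => P u = P v) + #{u ∈ X | P u = P v} ≤ m := by
      rw [← hP (P v), ← card_union_of_disjoint]
      · refine card_le_card (union_subset inter_subset_right ?_)
        exact filter_subset_filter _ (subset_univ X)
      · exact disjoint_of_subset_left inter_subset_left
          (disjoint_of_subset_right (filter_subset _ _) hIX)
    omega
  have hSU : insert w S ⊆ U := by
    refine hind _ (by rw [card_insert_of_notMem hwS, hSc]) ?_ ?_
    · intro u hu v hv huv
      rw [mem_insert] at hu hv
      rcases hu with rfl | hu <;> rcases hv with rfl | hv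
      · exact G.irrefl huv
      · exact hXS v hv (hXw v huv)
      · exact hXS u hu (hXw u huv.symm)
      · refine hS _ ((memS u).1 hu) _ ((memS v).1 hv) ?_
        rwa [Equiv.apply_symm_apply, Equiv.apply_symm_apply]
    · exact disjoint_insert_left.2 ⟨hw, Finset.disjoint_left.2 hXS⟩
  have hRU : insert w R ⊆ U := by
    refine hind _ (by rw [card_insert_of_notMem hwR, hRc]) ?_ ?_
    · intro u hu v hv huv
      rw [mem_insert] at hu hv
      rcases hu with rfl | hu <;> rcases hv with rfl | hv
      · exact G.irrefl huv
      · exact hXR v hv (hXw v huv)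
      · exact hXR u hu (hXw u huv.symm)
      · refine hR _ ((memR u).1 hu) _ ((memR v).1 hv) ?_
        rwa [Equiv.symm_apply_apply, Equiv.symm_apply_apply]
    · exact disjoint_insert_left.2 ⟨hw, Finset.disjoint_left.2 hXR⟩
  have hlast : #(S ∪ R) + 1 ≤ 2 * m := by
    rw [← hUc, ← card_insert_of_notMem (a := w) (by simp [hwS, hwR])]
    refine card_le_card (insert_subset (hSU (mem_insert_self _ _)) (union_subset ?_ ?_))
    · exact (subset_insert _ _).trans hSU
    · exact (subset_insert _ _).trans hRU
  omega

end Count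

lemma degree_bounds {k m d : ℕ} (hk : 3 ≤ k) (hm : 1 ≤ m)
    (hc : (k / 2 + 2) * (k * m) + 3 ≤ 2 * (k / 2 + 1) * (d + m)) :
    k * m + 2 ≤ 2 * d + m ∧ 4 * (k * m) < 10 * d + 4 ∧ k * m + 1 < 3 * d ∧
      (k ≠ 4 → 2 * (k * m) < 4 * d + m + 2) ∧ (k = 4 → 5 * m + 2 ≤ 3 * d) := by
  obtain ⟨r, rfl⟩ := Nat.exists_eq_add_of_le' hm
  obtain ⟨p, rfl | rfl⟩ : ∃ p, k = 2 * p + 4 ∨ k = 2 * p + 3 := by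
    rcases Nat.even_or_odd' k with ⟨q, rfl | rfl⟩
    · exact ⟨q - 2, Or.inl (by omega)⟩
    · exact ⟨q - 1, Or.inr (by omega)⟩
  · rw [show (2 * p + 4) / 2 = p + 2 by omega] at hc
    refine ⟨?_, ?_, ?_, ?_, ?_⟩
    · by_contra! h
      nlinarith [Nat.mul_le_mul_left (p + 3) (Nat.le_of_lt_succ h), Nat.zero_le (p * r)]
    · by_contra! h
      nlinarith [Nat.mul_le_mul_left (p + 3) h, Nat.zero_le (p * r), Nat.zero_le (p ^ 2 * r)]
    · by_contra! h
      nlinarith [Nat.mul_le_mul_left (p + 3) h, Nat.zero_le (p * r), Nat.zero_le (p ^ 2 * r)]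
    · intro hk4
      obtain ⟨q, rfl⟩ := Nat.exists_eq_succ_of_ne_zero (n := p) (by rintro rfl; exact hk4 rfl)
      by_contra! h
      nlinarith [Nat.mul_le_mul_left (q + 4) h, Nat.zero_le (q * r), Nat.zero_le (q ^ 2 * r)]
    · intro hk4
      obtain rfl : p = 0 := by omega
      omega
  · rw [show (2 * p + 3) / 2 = p + 1 by omega] at hc
    refine ⟨?_, ?_, ?_, ?_, by omega⟩
    · by_contra! h
      nlinarith [Nat.mul_le_mul_left (p + 2) (Nat.le_of_lt_succ h), Nat.zero_le (p * r)]
    · by_contra! h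
      nlinarith [Nat.mul_le_mul_left (p + 2) h, Nat.zero_le (p * r), Nat.zero_le (p ^ 2 * r)]
    · by_contra! h
      nlinarith [Nat.mul_le_mul_left (p + 2) h, Nat.zero_le (p * r), Nat.zero_le (p ^ 2 * r)]
    · intro _
      by_contra! h
      nlinarith [Nat.mul_le_mul_left (p + 2) h, Nat.zero_le (p * r), Nat.zero_le (p ^ 2 * r)]

lemma exists_isHamiltonianList_of_multipartite {V : Type*} [Fintype V] [DecidableEq V]
    {G : SimpleGraph V} [DecidableRel G.Adj] {k m d : ℕ} {P : V → Fin k} (hk : 3 ≤ k)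
    (hV : 3 ≤ Fintype.card V) (hP : ∀ i, #{v | P v = i} = m)
    (hGP : ∀ u v, G.Adj u v → P u ≠ P v) (hd : ∀ v, d ≤ #{u | G.Adj v u})
    (hn : Fintype.card V = k * m)
    (hc : (k / 2 + 2) * (k * m) + 3 ≤ 2 * (k / 2 + 1) * (d + m)) :
    ∃ l, IsHamiltonianList G l := by
  classical
  have hm : 1 ≤ m := by
    rcases Nat.eq_zero_or_pos m with rfl | h
    · simp at hn; omega
    · exact h
  obtain ⟨h1, h2, h3, h6, h4⟩ := degree_bounds hk hm hc
  rcases Nat.lt_or_ge (2 * d) (Fintype.card V) with hdn | hdn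
  swap
  · exact exists_isHamiltonianList_of_card_le_two_mul hV hd hdn
  by_contra! hG
  obtain ⟨H, hGH, hHK, hH, hpath⟩ :=
    exists_maximal_isHamiltonianPathList (K := (⊤ : SimpleGraph (Fin k)).comap P) hV
      (fun u v h => by simpa using hGP u v h) hG
  have hHP : ∀ u v, H.Adj u v → P u ≠ P v := fun u v h => by simpa using hHK h
  have hdH : ∀ v, d ≤ #{u | H.Adj v u} := fun v =>
    (hd v).trans (card_le_card fun w => by simpa using fun h => hGH h)
  by_cases hcr : ∃ u v, P u ≠ P v ∧ ¬ H.Adj u v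
  · obtain ⟨u, v, huv, hn'⟩ := hcr
    obtain ⟨l, hl⟩ := hpath u v (by simpa using huv) hn'
    obtain ⟨C₀, Q₀, hcov₀, hQ₀⟩ := exists_isCyclePathCover_of_path hl hH hdH hHP (hP _)
      (by rw [hn]; exact h1)
    obtain ⟨C, w, hcov⟩ := hcov₀.exists_singleton hH hdH hQ₀ (by rw [hn]; exact h3)
      (by rw [hn]; exact h2)
    have hlen : C.length + 1 = Fintype.card V := by
      rw [← card_univ, ← show (C ++ [w]).toFinset = univ by ext z; simpa [or_comm] using hcov.mem z,
        List.toFinset_card_of_nodup hcov.nodup, List.length_append, List.length_singleton]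
    have hav := hcov.isCycleAvoiding (by omega)
    obtain ⟨X, hXw, hw, hX, hY, hS, hR⟩ := hav.exists_hopping_set hH
    have hmem : ∀ v, v ∈ X.toFinset ↔ v ∈ X := fun v => Set.mem_toFinset
    refine false_of_hopping_set (X := X.toFinset) hP hHP hdH hn hc h1 h6 h4 hav.apply_self
      ?_ ?_ ?_ ?_ ?_ ?_ <;> simp only [hmem] <;> assumption
  · push Not at hcr
    obtain ⟨l, hl⟩ := exists_isHamiltonianList_of_card_le_two_mul (G := H) hV
      (d := Fintype.card V - m) (fun v => by
        have h5 := card_filter_add_card_filter_not (s := (univ : Finset V)) (fun u => P u = P v)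
        rw [hP, card_univ] at h5
        have h7 : #{u | ¬ P u = P v} ≤ #{u | H.Adj v u} := card_le_card fun u hu => by
          simp only [mem_filter, mem_univ, true_and] at hu ⊢
          exact hcr v u (Ne.symm hu)
        omega) (by
        have : 3 * m ≤ k * m := Nat.mul_le_mul_right _ hk
        omega)
    exact hH l hl

lemma le_of_degBound_le {k m d : ℕ} (hk : 2 ≤ k) (h : degBound (k * m) k + 1 ≤ d) :
    (k / 2 + 2) * (k * m) + 3 ≤ 2 * (k / 2 + 1) * (d + m) := by
  have hceil : ⌈((k : ℚ) + 1) / 2⌉ = ((k / 2 + 1 : ℕ) : ℤ) := by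
    rw [Int.ceil_eq_iff]
    have h1 : k ≤ 2 * (k / 2) + 1 := by omega
    have h2 : 2 * (k / 2) ≤ k := by omega
    have h1' : (k : ℚ) ≤ 2 * ((k / 2 : ℕ) : ℚ) + 1 := by exact_mod_cast h1
    have h2' : 2 * ((k / 2 : ℕ) : ℚ) ≤ k := by exact_mod_cast h2
    rw [Int.cast_natCast, Nat.cast_add_one]
    constructor <;> linarith
  rw [degBound, hceil] at h
  have hdiv : ((k * m : ℕ) : ℚ) / k = m := by
    have : (k : ℚ) ≠ 0 := by positivity
    push_cast; field_simp
  rw [hdiv] at h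
  set n := k * m with hn
  set c := k / 2 + 1 with hc
  set A := ⌈(n : ℚ) / 2⌉ with hA
  set F := ⌊((n : ℚ) + 2) / (2 * (((c : ℕ) : ℤ) : ℚ))⌋ with hF
  have hA' : (n : ℚ) / 2 ≤ A := Int.le_ceil _
  have hF' : ((n : ℚ) + 2) / (2 * (((c : ℕ) : ℤ) : ℚ)) < F + 1 := Int.lt_floor_add_one _
  have hcpos : (0 : ℚ) < 2 * (((c : ℕ) : ℤ) : ℚ) := by
    have : 0 < c := Nat.succ_pos _
    positivity
  rw [div_lt_iff₀ hcpos] at hF'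
  have e1 : (n : ℤ) ≤ 2 * A := by
    have : (n : ℚ) ≤ 2 * A := by linarith
    exact_mod_cast this
  have e2 : (n : ℤ) + 3 ≤ (F + 1) * (2 * c) := by
    have : (n : ℤ) + 2 < (F + 1) * (2 * c) := by exact_mod_cast hF'
    omega
  have e3 : A + F + 1 ≤ (d : ℤ) + m := by
    have : (A : ℚ) + F + 1 ≤ d + m := by linarith
    exact_mod_cast this
  have hc0 : (0 : ℤ) ≤ c := Int.natCast_nonneg _
  rw [show k / 2 + 2 = c + 1 from rfl]
  zify
  nlinarith [mul_le_mul_of_nonneg_left e3 hc0, mul_le_mul_of_nonneg_left e1 hc0]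

/-- For `k ≥ 2`, every balanced `k`-partite graph on `n ≥ 3` vertices with minimum degree at
least `⌈n/2⌉ + ⌊(n+2)/(2⌈(k+1)/2⌉)⌋ − n/k + 1` has a Hamiltonian cycle. -/
theorem balanced_kpartite_hamiltonian_plus_one
    {V : Type*} [Fintype V] [DecidableEq V] (G : SimpleGraph V) [DecidableRel G.Adj]
    (k n : ℕ) (hk : 2 ≤ k) (hn : 3 ≤ n) (hcard : Fintype.card V = n) (hdvd : k ∣ n)
    (hG : IsBalancedKPartite G k)
    (hδ : degBound n k + 1 ≤ (G.minDegree : ℚ)) :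
    G.IsHamiltonian := by
  obtain ⟨P, hP, hGP⟩ := hG
  obtain ⟨m, rfl⟩ := hdvd
  have hk0 : 0 < k := by omega
  simp only [hcard, Nat.mul_div_cancel_left m hk0] at hP
  have hd : ∀ v, G.minDegree ≤ #{u | G.Adj v u} := fun v => by
    rw [← neighborFinset_eq_filter]
    exact G.minDegree_le_degree v
  have hV : 3 ≤ Fintype.card V := hcard ▸ hn
  have hc := le_of_degBound_le hk hδ
  suffices h : ∃ l, IsHamiltonianList G l from h.elim fun l hl => hl.isHamiltonian hV
  rcases hk.eq_or_lt with rfl | hk3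
  · exact exists_isHamiltonianList_of_bipartite P hP hGP hV hd (by omega)
  · exact exists_isHamiltonianList_of_multipartite hk3 hV hP hGP hd hcard hc
end

section
/- Let G be a graph on n vertices. If G is 2-connected and δ(G) ≥ (n+2)/3, then every longest cycle of G is strongly dominating. -/
open SimpleGraph Finset

/-- `G` is 2-connected: it has at least 3 vertices and remains connected after the
deletion of any single vertex. -/
def TwoConnected {V : Type*} [Fintype V] (G : SimpleGraph V) : Prop :=
  3 ≤ Fintype.card V ∧ ∀ v : V, (G.induce {w | w ≠ v}).Connected

/-- A cycle `p` in `G` is strongly dominating if the vertices off the cycle form an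
independent set, and no two vertices of the union of the neighbourhoods of the off-cycle
vertices appear consecutively on the cycle. -/
def IsStronglyDominating {V : Type*} (G : SimpleGraph V) {v : V} (p : G.Walk v v) : Prop :=
  (∀ a b : V, a ∉ p.support → b ∉ p.support → ¬ G.Adj a b) ∧
  (∀ a b : V, (∃ u, u ∉ p.support ∧ G.Adj u a) → (∃ u, u ∉ p.support ∧ G.Adj u b) →
    s(a, b) ∉ p.edges)

/-- `l` lists the vertices of a path of `G` from `x` to `y`. -/
structure IsListPath {V : Type*} (G : SimpleGraph V) (l : List V) (x y : V) : Prop where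
  chain : l.IsChain G.Adj
  nodup : l.Nodup
  head : l.head? = some x
  last : l.getLast? = some y

namespace IsListPath

variable {V : Type*} {G : SimpleGraph V} {l l' l₁ l₂ : List V} {x y z x' y' : V}

lemma singleton (x : V) : IsListPath G [x] x x := ⟨by simp, by simp, by simp, by simp⟩

lemma append (h : IsListPath G l x y) (h' : IsListPath G l' x' y') (hadj : G.Adj y x')
    (hd : ∀ v ∈ l, v ∉ l') : IsListPath G (l ++ l') x y' := by
  obtain ⟨a, b, c, d⟩ := h
  obtain ⟨a', b', c', d'⟩ := h'
  refine ⟨?_, ?_, ?_, ?_⟩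
  · rw [List.isChain_append]
    refine ⟨a, a', ?_⟩
    simp [d, c', hadj]
  · rw [List.nodup_append']
    exact ⟨b, b', fun v hv hv' => hd v hv hv'⟩
  · simp [c]
  · simp [d']

lemma reverse (h : IsListPath G l x y) : IsListPath G l.reverse y x := by
  obtain ⟨a, b, c, d⟩ := h
  refine ⟨?_, ?_, ?_, ?_⟩
  · rw [List.isChain_reverse]
    exact a.imp fun _ _ h => h.symm
  · simpa using b
  · simpa using d
  · simpa using c

lemma right_of_append (h : IsListPath G (l₁ ++ z :: l₂) x y) : IsListPath G (z :: l₂) z y := by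
  obtain ⟨a, b, c, d⟩ := h
  refine ⟨a.right_of_append, b.of_append_right, by simp, ?_⟩
  simpa using d

lemma left_of_append (h : IsListPath G (l₁ ++ z :: l₂) x y) : IsListPath G (l₁ ++ [z]) x z := by
  have := h.reverse
  simp only [List.reverse_append, List.reverse_cons, List.append_assoc] at this
  simpa using this.right_of_append.reverse

lemma head_mem (h : IsListPath G l x y) : x ∈ l := List.mem_of_mem_head? h.head

lemma last_mem (h : IsListPath G l x y) : y ∈ l := List.mem_of_mem_getLast? h.last

/-- Two paths ending and starting at the same vertex `z`, glued there. -/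
lemma glue (h : IsListPath G (l ++ [z]) x z) (h' : IsListPath G l' z y')
    (hd : ∀ v ∈ l, v ∉ l') : IsListPath G (l ++ l') x y' := by
  obtain ⟨a, b, c, d⟩ := h
  obtain ⟨a', b', c', d'⟩ := h'
  obtain ⟨m, rfl⟩ : ∃ m, l' = z :: m := by
    cases l' <;> simp_all
  refine ⟨?_, ?_, ?_, ?_⟩
  · rw [List.isChain_split]
    exact ⟨a, a'⟩
  · rw [List.nodup_append']
    exact ⟨b.of_append_left, b', fun v hv hv' => hd v hv hv'⟩
  · cases l <;> simp_all
  · simp [d']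

end IsListPath

section

variable {V : Type*} {G : SimpleGraph V}

lemma exists_isListPath_of_connected_induce {s : Set V} (h : (G.induce s).Connected) {a b : V}
    (ha : a ∈ s) (hb : b ∈ s) : ∃ l, IsListPath G l a b ∧ ∀ v ∈ l, v ∈ s := by
  classical
  obtain ⟨p, hp⟩ := h.exists_isPath ⟨a, ha⟩ ⟨b, hb⟩
  refine ⟨p.support.map Subtype.val, ⟨?_, ?_, ?_, ?_⟩, ?_⟩
  · rw [List.isChain_map]
    exact p.isChain_adj_support.imp fun _ _ h => h
  · exact hp.support_nodup.map Subtype.val_injective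
  · rw [List.head?_map, List.head?_eq_some_head p.support_ne_nil]
    simp
  · rw [List.getLast?_map, List.getLast?_eq_some_getLast p.support_ne_nil]
    simp
  · intro v hv
    simp only [List.mem_map] at hv
    obtain ⟨w, -, rfl⟩ := hv
    exact w.2

lemma exists_isListPath_between {s : Set V} (h : (G.induce s).Connected) {T Z : Set V}
    (hT : (T ∩ s).Nonempty) (hZ : (Z ∩ s).Nonempty) :
    ∃ l t z, IsListPath G l t z ∧ t ∈ T ∧ z ∈ Z ∧ (∀ v ∈ l, v ∈ s) ∧
      (∀ v ∈ l, v ∈ T → v = t) ∧ (∀ v ∈ l, v ∈ Z → v = z) := by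
  classical
  have hex : ∃ n, ∃ l t z, IsListPath G l t z ∧ t ∈ T ∧ z ∈ Z ∧ (∀ v ∈ l, v ∈ s) ∧
      l.length = n := by
    obtain ⟨t, ht, hts⟩ := hT
    obtain ⟨z, hz, hzs⟩ := hZ
    obtain ⟨l, hl, hls⟩ := exists_isListPath_of_connected_induce h hts hzs
    exact ⟨_, l, t, z, hl, ht, hz, hls, rfl⟩
  obtain ⟨l, t, z, hl, ht, hz, hls, hlen⟩ := Nat.find_spec hex
  have hmin : ∀ l' t' z', IsListPath G l' t' z' → t' ∈ T → z' ∈ Z → (∀ v ∈ l', v ∈ s) →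
      l.length ≤ l'.length := fun l' t' z' h1 h2 h3 h4 =>
    hlen ▸ Nat.find_min' hex ⟨l', t', z', h1, h2, h3, h4, rfl⟩
  refine ⟨l, t, z, hl, ht, hz, hls, ?_, ?_⟩
  · intro v hv hvT
    obtain ⟨l₁, l₂, rfl⟩ := List.append_of_mem hv
    have := hmin _ _ _ hl.right_of_append hvT hz (fun w hw => hls w (by simp at hw ⊢; tauto))
    have : l₁ = [] := List.eq_nil_of_length_eq_zero (by
      simp only [List.length_append, List.length_cons] at this
      omega)
    subst this
    simpa using hl.head
  · intro v hv hvZ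
    obtain ⟨l₁, l₂, rfl⟩ := List.append_of_mem hv
    have := hmin _ _ _ hl.left_of_append ht hvZ (fun w hw => hls w (by simp at hw ⊢; tauto))
    have : l₂ = [] := List.eq_nil_of_length_eq_zero (by
      simp only [List.length_append, List.length_cons, List.length_nil] at this
      omega)
    subst this
    simpa using hl.last

/-- A form of Menger's theorem for two paths: a path `L` from `x` to `S` avoiding `T` can be
replaced by two disjoint paths to `S`, one from `x` and one from `T`. -/
lemma exists_two_disjoint_paths (hG : ∀ v : V, (G.induce {w | w ≠ v}).Connected) {S : Set V}
    (hS : S.Nontrivial) (L : List V) (T : Set V) (x s : V) (hL : IsListPath G L x s) (hs : s ∈ S)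
    (hLS : ∀ v ∈ L, v ∈ S → v = s) (hT : T.Nonempty) (hTS : ∀ v ∈ T, v ∉ S)
    (hLT : ∀ v ∈ L, v ∉ T) :
    ∃ P₁ P₂ s₁ s₂ t, IsListPath G P₁ x s₁ ∧ IsListPath G P₂ t s₂ ∧ s₁ ∈ S ∧ s₂ ∈ S ∧ t ∈ T ∧
      (∀ v ∈ P₁, v ∉ P₂) ∧ (∀ v ∈ P₁, v ∈ S → v = s₁) ∧ (∀ v ∈ P₂, v ∈ S → v = s₂) ∧
      (∀ v ∈ P₁, v ∉ T) ∧ (∀ v ∈ P₂, v ∈ T → v = t) := by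
  induction hn : L.length using Nat.strong_induction_on generalizing L T x s with
  | _ n ih =>
  have hxL := hL.head_mem
  obtain ⟨R, t, z, hR, ht, hz, hRx, hRT, hRZ⟩ := exists_isListPath_between (hG x) (T := T)
    (Z := {v | (v ∈ S ∨ v ∈ L) ∧ v ≠ x})
    (hT.imp fun v hv => ⟨hv, fun h => hLT _ hxL (h ▸ hv)⟩)
    (by
      obtain ⟨y, hy, hyx⟩ := hS.exists_ne x
      exact ⟨y, ⟨Or.inl hy, hyx⟩, hyx⟩)
  obtain ⟨hzSL, hzx⟩ := hz
  by_cases hzL : z ∈ L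
  · obtain ⟨M, N, rfl⟩ := List.append_of_mem hzL
    obtain ⟨M', rfl⟩ : ∃ M', M = x :: M' := by
      have := hL.head
      cases M with
      | nil => simp at this; exact absurd this hzx
      | cons a M' => simp at this; exact ⟨M', by rw [this]⟩
    obtain ⟨R', rfl⟩ : ∃ R', R = R' ++ [z] := by
      have := hR.last
      rw [List.getLast?_eq_some_iff] at this
      exact this
    have hMN : ∀ v ∈ x :: M', v ∉ z :: N := fun v hv hv' =>
      (List.nodup_append'.1 hL.nodup).2.2 hv hv'
    have hzR : z ∉ R' := fun h => (List.nodup_append'.1 hR.nodup).2.2 h (by simp)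
    have hMS : ∀ v ∈ x :: M', v ∉ S := fun v hv hvS => by
      have := hLS v (List.mem_append_left _ hv) hvS
      exact hMN v hv (this ▸ hL.right_of_append.last_mem)
    have hRL : ∀ v ∈ R', v ∉ S ∧ v ∉ x :: M' ++ z :: N := fun v hv => by
      have hvR : v ∈ R' ++ [z] := List.mem_append_left _ hv
      have hvz : v ≠ z := fun h => hzR (h ▸ hv)
      exact ⟨fun h => hvz (hRZ v hvR ⟨Or.inl h, hRx v hvR⟩),
        fun h => hvz (hRZ v hvR ⟨Or.inr h, hRx v hvR⟩)⟩
    obtain ⟨P₁, P₂, s₁, s₂, t', h1, h2, hs₁, hs₂, ht', hd, hP₁S, hP₂S, hP₁T, hP₂T⟩ :=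
      ih _ (by simp at hn ⊢; omega) (z :: N) {v | v ∈ T ∨ v ∈ x :: M' ∨ v ∈ R'} z s
        hL.right_of_append hs (fun v hv => hLS v (by simp at hv ⊢; tauto))
        ⟨x, by simp⟩
        (by
          rintro v (hv | hv | hv)
          exacts [hTS v hv, hMS v hv, (hRL v hv).1])
        (by
          rintro v hv (hv' | hv' | hv')
          exacts [hLT v (List.mem_append_right _ hv) hv', hMN v hv' hv,
            (hRL v hv').2 (List.mem_append_right _ hv)])
        rfl
    simp only [Set.mem_ofPred_eq] at hP₁T hP₂T ht'
    have hRM : ∀ v ∈ R', v ∉ x :: M' := fun v hv h => (hRL v hv).2 (List.mem_append_left _ h)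
    have hMT : ∀ v ∈ x :: M', v ∉ T := fun v hv => hLT v (List.mem_append_left _ hv)
    have hRT' : ∀ v ∈ R', v ∈ T → v = t := fun v hv => hRT v (List.mem_append_left _ hv)
    have hMP : IsListPath G (x :: M' ++ P₁) x s₁ :=
      hL.left_of_append.glue h1 fun v hv hv' => hP₁T v hv' (Or.inr (Or.inl hv))
    have hRP : IsListPath G (R' ++ P₁) t s₁ :=
      hR.glue h1 fun v hv hv' => hP₁T v hv' (Or.inr (Or.inr hv))
    by_cases hcM : t' ∈ x :: M'
    · obtain ⟨M₁, M₂, hM⟩ := List.append_of_mem hcM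
      rw [hM] at hL hRM hMT hMS hP₂T hP₁T
      have hL' : IsListPath G (M₁ ++ t' :: (M₂ ++ z :: N)) x s := by simpa using hL
      have hnd : ∀ v ∈ M₁, v ≠ t' := fun v hv hv' =>
        (List.nodup_append'.1 hL'.nodup).2.2 hv (by simp [hv'])
      have key : ∀ v ∈ M₁, v ∉ P₂ := fun v hv hv' =>
        hnd v hv (hP₂T v hv' (Or.inr (Or.inl (List.mem_append_left _ hv))))
      refine ⟨M₁ ++ P₂, R' ++ P₁, s₂, s₁, t, hL'.left_of_append.glue h2 key, hRP,
        hs₂, hs₁, ht, ?_, ?_, ?_, ?_, ?_⟩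
      all_goals
        clear ih hn hL hR hRx hRZ hLS hLT hM hL' hMP hRP
        simp only [List.mem_append, List.mem_cons] at *
        grind
    by_cases hcR : t' ∈ R'
    · obtain ⟨R₁, R₂, rfl⟩ := List.append_of_mem hcR
      have hR' : IsListPath G (R₁ ++ t' :: (R₂ ++ [z])) t z := by simpa using hR
      have hnd : ∀ v ∈ R₁, v ≠ t' := fun v hv hv' =>
        (List.nodup_append'.1 hR'.nodup).2.2 hv (by simp [hv'])
      have key : ∀ v ∈ R₁, v ∉ P₂ := fun v hv hv' =>
        hnd v hv (hP₂T v hv' (Or.inr (Or.inr (List.mem_append_left _ hv))))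
      refine ⟨(x :: M') ++ P₁, R₁ ++ P₂, s₁, s₂, t, hMP, hR'.left_of_append.glue h2 key,
        hs₁, hs₂, ht, ?_, ?_, ?_, ?_, ?_⟩
      all_goals
        clear ih hn hL hR hRx hRZ hLS hLT hR' hMP hRP
        simp only [List.mem_append, List.mem_cons] at *
        grind
    · refine ⟨(x :: M') ++ P₁, P₂, s₁, s₂, t', hMP, h2, hs₁, hs₂, by tauto, ?_, ?_, ?_, ?_, ?_⟩
      all_goals
        clear ih hn hL hR hRx hRZ hLS hLT hMP hRP
        simp only [List.mem_append, List.mem_cons] at *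
        grind
  · have hzS : z ∈ S := hzSL.resolve_right hzL
    refine ⟨L, R, s, z, t, hL, hR, hs, hzS, ht, ?_, hLS, ?_, hLT, hRT⟩
    · intro v hv hvR
      by_cases hvx : v = x
      · exact hRx v hvR hvx
      · exact hzL (hRZ v hvR ⟨Or.inr hv, hvx⟩ ▸ hv)
    · intro v hv hvS
      exact hRZ v hv ⟨Or.inl hvS, hRx v hv⟩

end

section

variable {V : Type*} {G : SimpleGraph V}

lemma IsListPath.exists_isCycle {l : List V} {x y : V} (h : IsListPath G l x y)
    (hadj : G.Adj y x) (hlen : 3 ≤ l.length) :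
    ∃ (w : V) (q : G.Walk w w), q.IsCycle ∧ q.length = l.length := by
  classical
  have hne : l ≠ [] := List.ne_nil_of_length_pos (by omega)
  have hx : l.head hne = x := by
    have := h.head
    rw [List.head?_eq_some_head hne] at this
    exact Option.some.inj this
  have hy : l.getLast hne = y := by
    have := h.last
    rw [List.getLast?_eq_some_getLast hne] at this
    exact Option.some.inj this
  subst hx hy
  let q := Walk.ofSupport l hne h.chain
  have hq : q.length = l.length - 1 := Walk.length_ofSupport hne h.chain
  have hqp : q.IsPath := by
    rw [Walk.isPath_def, Walk.support_ofSupport]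
    exact h.nodup
  refine ⟨_, Walk.cons hadj q, ?_, by simp [hq]; omega⟩
  rw [Walk.cons_isCycle_iff]
  refine ⟨hqp, fun he => ?_⟩
  have := hqp.length_eq_one_of_mem_edges (Sym2.eq_swap ▸ he)
  omega

/-- `f` is a periodic enumeration of a longest cycle of `G`, of length `c`. -/
structure IsLongestCycleEnum (G : SimpleGraph V) (f : ℕ → V) (c : ℕ) : Prop where
  three_le : 3 ≤ c
  periodic : ∀ i, f (i + c) = f i
  adj : ∀ i, G.Adj (f i) (f (i + 1))
  inj : ∀ i j, i < j → j < i + c → f i ≠ f j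
  longest : ∀ l x y, IsListPath G l x y → G.Adj y x → 3 ≤ l.length → l.length ≤ c

lemma SimpleGraph.Walk.IsCycle.isLongestCycleEnum {v : V} {p : G.Walk v v} (hp : p.IsCycle)
    (hmax : ∀ (w : V) (q : G.Walk w w), q.IsCycle → q.length ≤ p.length) :
    IsLongestCycleEnum G (fun i => p.getVert (i % p.length)) p.length := by
  have h3 := hp.three_le_length
  refine ⟨h3, fun i => by simp, fun i => ?_, fun i j hij hj he => ?_, fun l x y hl hadj hlen => ?_⟩
  · have hi := Nat.mod_lt i (show 0 < p.length by omega)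
    have := p.adj_getVert_succ hi
    have h2 : p.getVert ((i + 1) % p.length) = p.getVert (i % p.length + 1) := by
      rcases Nat.lt_or_ge (i % p.length + 1) p.length with h | h
      · rw [Nat.add_mod, Nat.mod_eq_of_lt (show 1 < p.length by omega), Nat.mod_eq_of_lt h]
      · have h' : i % p.length + 1 = p.length := by omega
        rw [Nat.add_mod, Nat.mod_eq_of_lt (show 1 < p.length by omega), h']
        simp
    rwa [← h2] at this
  · have hi := Nat.mod_lt i (show 0 < p.length by omega)
    have hj' := Nat.mod_lt j (show 0 < p.length by omega)
    have := hp.getVert_injOn' (by rw [Set.mem_ofPred_eq]; omega)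
      (by rw [Set.mem_ofPred_eq]; omega) he
    have h0 : (j - i) % p.length = 0 := Nat.sub_mod_eq_zero_of_mod_eq this.symm
    rw [Nat.mod_eq_of_lt (by omega)] at h0
    omega
  · obtain ⟨w, q, hq, hqlen⟩ := hl.exists_isCycle hadj hlen
    exact hqlen ▸ hmax w q hq

namespace IsLongestCycleEnum

variable {f : ℕ → V} {c : ℕ}

lemma shift (h : IsLongestCycleEnum G f c) (s : ℕ) :
    IsLongestCycleEnum G (fun i => f (i + s)) c where
  three_le := h.three_le
  periodic i := by rw [show i + c + s = i + s + c by omega, h.periodic]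
  adj i := by rw [show i + 1 + s = i + s + 1 by omega]; exact h.adj _
  inj i j hij hj := h.inj _ _ (by omega) (by omega)
  longest := h.longest

lemma exists_mem_window (h : IsLongestCycleEnum G f c) (s i : ℕ) :
    ∃ j, s ≤ j ∧ j < s + c ∧ f j = f i := by
  have h3 := h.three_le
  have hmul : ∀ n i, f (i + n * c) = f i := fun n => by
    induction n with
    | zero => simp
    | succ n ih => intro i; rw [Nat.succ_mul, ← add_assoc, h.periodic, ih]
  induction s with
  | zero =>
    refine ⟨i % c, by omega, by simpa using Nat.mod_lt i (by omega), ?_⟩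
    rw [← hmul (i / c) (i % c), Nat.mul_comm, Nat.mod_add_div]
  | succ s ih =>
    obtain ⟨j, h1, h2, h4⟩ := ih
    by_cases hj : j = s
    · exact ⟨j + c, by omega, by omega, by rw [h.periodic, h4]⟩
    · exact ⟨j, by omega, by omega, h4⟩

/-- The arc of the cycle through `f a, f (a + 1), …, f b`. -/
lemma isListPath_arc (h : IsLongestCycleEnum G f c) {a b : ℕ} (hab : a ≤ b) (hb : b < a + c) :
    IsListPath G ((List.range' a (b + 1 - a)).map f) (f a) (f b) := by
  refine ⟨?_, ?_, ?_, ?_⟩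
  · rw [List.isChain_map]
    refine (List.isChain_range' a (b + 1 - a) 1).imp ?_
    rintro i _ rfl
    exact h.adj i
  · rw [List.nodup_map_iff_inj_on (List.nodup_range' (step := 1))]
    intro i hi j hj he
    simp only [List.mem_range'_1] at hi hj
    by_contra hne
    rcases Nat.lt_or_gt_of_ne hne with hlt | hlt
    · exact h.inj i j hlt (by omega) he
    · exact h.inj j i hlt (by omega) he.symm
  · rw [List.head?_map, List.head?_range']
    simp; omega
  · rw [List.getLast?_map, List.getLast?_range']
    simp; refine ⟨by omega, ?_⟩
    congr 1; omega

/-- A path off the cycle joining two vertices of the cycle is no longer than the arc. -/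
lemma length_lt_of_isListPath (h : IsLongestCycleEnum G f c) {P : List V} {x y : V}
    (hP : IsListPath G P x y) (hoff : ∀ v ∈ P, ∀ k, f k ≠ v) {i j : ℕ} (hij : i < j)
    (hj : j < i + c) (hx : G.Adj x (f i)) (hy : G.Adj y (f j)) : P.length + i + 1 ≤ j := by
  have hlen : 1 ≤ P.length := List.length_pos_of_mem hP.head_mem
  have harc := h.isListPath_arc (a := j) (b := i + c) (by omega) (by omega)
  have := h.longest _ _ _ (hP.append harc hy ?_) ?_ ?_
  · simp at this
    omega
  · intro v hv hv'
    obtain ⟨k, -, hk⟩ := List.mem_map.1 hv'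
    exact hoff v hv k hk
  · rw [h.periodic]
    exact hx.symm
  · simp; omega

end IsLongestCycleEnum

end

lemma Nat.exists_adjacent_pair {A B : ℕ → Prop} {a b : ℕ} (hab : a < b) (ha : A a) (hb : B b) :
    ∃ a' b', a ≤ a' ∧ a' < b' ∧ b' ≤ b ∧ A a' ∧ B b' ∧ ∀ i, a' < i → i < b' → ¬ A i ∧ ¬ B i := by
  induction hn : b - a using Nat.strong_induction_on generalizing a b with
  | _ n ih =>
  by_cases h : ∀ i, a < i → i < b → ¬ A i ∧ ¬ B i
  · exact ⟨a, b, le_rfl, hab, le_rfl, ha, hb, h⟩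
  · push Not at h
    obtain ⟨i, h1, h2, h3⟩ := h
    by_cases hA : A i
    · obtain ⟨a', b', h4⟩ := ih (b - i) (by omega) h2 hA hb rfl
      exact ⟨a', b', by omega, h4.2⟩
    · obtain ⟨a', b', h4⟩ := ih (i - a) (by omega) h1 ha (h3 hA) rfl
      exact ⟨a', b', h4.1, h4.2.1, by omega, h4.2.2.2⟩

namespace IsLongestCycleEnum

variable {V : Type*} {G : SimpleGraph V} {f : ℕ → V} {c : ℕ}

lemma apply_period (h : IsLongestCycleEnum G f c) : f 0 = f c := by
  simpa using (h.periodic 0).symm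

lemma card_le_card_filter [DecidableEq V] (h : IsLongestCycleEnum G f c) (A : Finset V)
    (hA : ∀ v ∈ A, ∃ k, f k = v) (s : ℕ) : #A ≤ #{i ∈ Finset.range c | f (i + s) ∈ A} := by
  refine (Finset.card_le_card ?_).trans
    (Finset.card_image_le (s := {i ∈ Finset.range c | f (i + s) ∈ A}) (f := fun i => f (i + s)))
  intro v hv
  obtain ⟨k, rfl⟩ := hA v hv
  obtain ⟨j, h1, h2, h3⟩ := h.exists_mem_window s k
  refine Finset.mem_image.2 ⟨j - s, ?_, ?_⟩
  · rw [Finset.mem_filter, Finset.mem_range, Nat.sub_add_cancel h1, h3]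
    exact ⟨by omega, hv⟩
  · rw [Nat.sub_add_cancel h1, h3]

/-- If the ends `x`, `y` of a path off a longest cycle have distinct neighbours on the cycle, then
the cycle has room for the neighbours of `x`, counted twice, those of `y`, and two long gaps. -/
lemma two_mul_card_add_card_le [DecidableEq V] (h : IsLongestCycleEnum G f c) {P : List V}
    {x y : V} (hP : IsListPath G P x y) (hoff : ∀ v ∈ P, ∀ k, f k ≠ v) (hlen : 2 ≤ P.length)
    {A B : Finset V} (hA : ∀ v ∈ A, G.Adj x v ∧ ∃ k, f k = v)
    (hB : ∀ v ∈ B, G.Adj y v ∧ ∃ k, f k = v) {q : ℕ} (hq : 0 < q) (hqc : q < c)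
    (h0A : f 0 ∈ A) (hqB : f q ∈ B) : 2 * #A + #B + 2 * P.length ≤ c + 4 := by
  set p := P.length with hp
  have hAB : ∀ i j, i < j → j < i + c → f i ∈ A → f j ∈ B → p + i + 1 ≤ j :=
    fun i j hij hj hi hj' => h.length_lt_of_isListPath hP hoff hij hj (hA _ hi).1 (hB _ hj').1
  have hBA : ∀ i j, i < j → j < i + c → f i ∈ B → f j ∈ A → p + i + 1 ≤ j :=
    fun i j hij hj hi hj' => by
      simpa using h.length_lt_of_isListPath hP.reverse (by simpa using hoff) hij hj
        (hB _ hi).1 (hA _ hj').1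
  have hAA : ∀ i j, i < j → j < i + c → f i ∈ A → f j ∈ A → 1 + i + 1 ≤ j :=
    fun i j hij hj hi hj' =>
      h.length_lt_of_isListPath (IsListPath.singleton x) (by simpa using hoff x hP.head_mem)
        hij hj (hA _ hi).1 (hA _ hj').1
  have hcA : f c ∈ A := h.apply_period ▸ h0A
  obtain ⟨a₁, b₁, h1, h2, h3, ha₁, hb₁, hg₁⟩ :=
    Nat.exists_adjacent_pair (A := fun i => f i ∈ A) (B := fun i => f i ∈ B) hq h0A hqB
  obtain ⟨b₂, a₂, h4, h5, h6, hb₂, ha₂, hg₂⟩ :=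
    Nat.exists_adjacent_pair (A := fun i => f i ∈ B) (B := fun i => f i ∈ A) hqc hqB hcA
  have hd₁ := hAB a₁ b₁ h2 (by omega) ha₁ hb₁
  have hd₂ := hBA b₂ a₂ h5 (by omega) hb₂ ha₂
  let S₀ : Finset ℕ := {i ∈ Finset.range c | f (i + 0) ∈ B}
  let S₁ : Finset ℕ := {i ∈ Finset.range c | f (i + (c - 1)) ∈ A}
  let S₂ : Finset ℕ := {i ∈ Finset.range c | f (i + (c - 2)) ∈ A}
  let G₁ : Finset ℕ := Finset.Ico (a₁ + 3) (a₁ + p + 1)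
  let G₂ : Finset ℕ := Finset.Ico (b₂ + 3) (b₂ + p + 1)
  have hper : ∀ i d, d ≤ i → d ≤ c → f (i + (c - d)) = f (i - d) := fun i d hi hd => by
    rw [show i + (c - d) = i - d + c by omega, h.periodic]
  have hS₀S₁ : Disjoint S₀ S₁ := by
    refine Finset.disjoint_left.2 fun i hi hi' => ?_
    rw [Finset.mem_filter] at hi hi'
    have := hAB (i + (c - 1)) (i + c) (by omega) (by omega) hi'.2 (by rw [h.periodic]; exact hi.2)
    omega
  have hS₀S₂ : Disjoint S₀ S₂ := by
    refine Finset.disjoint_left.2 fun i hi hi' => ?_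
    rw [Finset.mem_filter] at hi hi'
    have := hAB (i + (c - 2)) (i + c) (by omega) (by omega) hi'.2 (by rw [h.periodic]; exact hi.2)
    omega
  have hS₁S₂ : Disjoint S₁ S₂ := by
    refine Finset.disjoint_left.2 fun i hi hi' => ?_
    rw [Finset.mem_filter] at hi hi'
    have := hAA (i + (c - 2)) (i + (c - 1)) (by omega) (by omega) hi'.2 hi.2
    omega
  have hgap : ∀ a b, p + a + 1 ≤ b → (∀ i, a < i → i < b → f i ∉ A ∧ f i ∉ B) →
      Disjoint (S₀ ∪ S₁ ∪ S₂) (Finset.Ico (a + 3) (a + p + 1)) := by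
    intro a b hab hg
    refine Finset.disjoint_left.2 fun i hi hi' => ?_
    rw [Finset.mem_Ico] at hi'
    simp only [Finset.mem_union, S₀, S₁, S₂, Finset.mem_filter] at hi
    rcases hi with (hi | hi) | hi
    · exact (hg i (by omega) (by omega)).2 hi.2
    · exact (hg (i - 1) (by omega) (by omega)).1 (hper i 1 (by omega) (by omega) ▸ hi.2)
    · exact (hg (i - 2) (by omega) (by omega)).1 (hper i 2 (by omega) (by omega) ▸ hi.2)
  have hG₁ : Disjoint (S₀ ∪ S₁ ∪ S₂) G₁ := hgap a₁ b₁ hd₁ hg₁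
  have hG₂ : Disjoint (S₀ ∪ S₁ ∪ S₂) G₂ :=
    hgap b₂ a₂ hd₂ fun i hi hi' => (hg₂ i hi hi').symm
  have hG₁G₂ : Disjoint G₁ G₂ := by
    refine Finset.disjoint_left.2 fun i hi hi' => ?_
    rw [Finset.mem_Ico] at hi hi'
    omega
  have hsub : S₀ ∪ S₁ ∪ S₂ ∪ G₁ ∪ G₂ ⊆ Finset.range c := by
    refine Finset.union_subset (Finset.union_subset (Finset.union_subset (Finset.union_subset
      (Finset.filter_subset _ _) (Finset.filter_subset _ _)) (Finset.filter_subset _ _)) ?_) ?_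
    all_goals
      intro i hi
      rw [Finset.mem_Ico] at hi
      rw [Finset.mem_range]
      omega
  have hcard := Finset.card_le_card hsub
  rw [Finset.card_union_of_disjoint (Finset.disjoint_union_left.2 ⟨hG₂, hG₁G₂⟩),
    Finset.card_union_of_disjoint hG₁,
    Finset.card_union_of_disjoint (Finset.disjoint_union_left.2 ⟨hS₀S₂, hS₁S₂⟩),
    Finset.card_union_of_disjoint hS₀S₁, Finset.card_range, Nat.card_Ico, Nat.card_Ico] at hcard
  have k₀ : #B ≤ #S₀ := h.card_le_card_filter B (fun v hv => (hB v hv).2) 0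
  have k₁ : #A ≤ #S₁ := h.card_le_card_filter A (fun v hv => (hA v hv).2) (c - 1)
  have k₂ : #A ≤ #S₂ := h.card_le_card_filter A (fun v hv => (hA v hv).2) (c - 2)
  omega

lemma add_length_le_card [Fintype V] [DecidableEq V] (h : IsLongestCycleEnum G f c) {P : List V}
    (hnd : P.Nodup) (hoff : ∀ v ∈ P, ∀ k, f k ≠ v) : c + P.length ≤ Fintype.card V := by
  have h3 := h.three_le
  have harc := h.isListPath_arc (a := 0) (b := c - 1) (by omega) (by omega)
  have hnd' : (P ++ (List.range' 0 (c - 1 + 1 - 0)).map f).Nodup := by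
    rw [List.nodup_append']
    refine ⟨hnd, harc.nodup, fun v hv hv' => ?_⟩
    obtain ⟨k, -, hk⟩ := List.mem_map.1 hv'
    exact hoff v hv k hk
  have := hnd'.length_le_card
  simp at this
  omega

/-- If `x`, `y` are distinct vertices with all neighbours on a longest cycle and they have
consecutive neighbours there, then `2 * degree x + degree y ≤ c + 2`. -/
lemma card_le_of_consecutive [DecidableEq V] (h : IsLongestCycleEnum G f c) {x y : V}
    (hxy : x ≠ y) (hx : ∀ k, f k ≠ x) (hy : ∀ k, f k ≠ y) {A B : Finset V}
    (hA : ∀ v ∈ A, G.Adj x v ∧ ∃ k, f k = v) (hB : ∀ v ∈ B, G.Adj y v ∧ ∃ k, f k = v)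
    (h0 : G.Adj x (f 0)) (h1 : G.Adj y (f 1)) : 2 * #A + #B ≤ c + 2 := by
  have h3 := h.three_le
  have hxc : G.Adj x (f c) := h.apply_period ▸ h0
  have hAB : ∀ i j, 1 ≤ i → i < j → j ≤ c → G.Adj x (f i) → G.Adj y (f j) → i + 3 ≤ j := by
    intro i j hi hij hj hxi hyj
    have p₁ := h.isListPath_arc (a := 1) (b := i) hi (by omega)
    have p₂ := (h.isListPath_arc (a := j) (b := c) hj (by omega)).reverse
    have p₃ := (p₁.append (IsListPath.singleton x) hxi.symm (by
      intro v hv hv'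
      obtain ⟨k, -, hk⟩ := List.mem_map.1 hv
      exact hx k (hk.trans (List.mem_singleton.1 hv')))).append p₂ hxc (by
      intro v hv hv'
      obtain ⟨k, hk, rfl⟩ := List.mem_map.1 (List.mem_reverse.1 hv')
      rcases List.mem_append.1 hv with hv | hv
      · obtain ⟨m, hm, hmk⟩ := List.mem_map.1 hv
        simp only [List.mem_range'_1] at hm hk
        exact h.inj m k (by omega) (by omega) hmk
      · exact hx k (List.mem_singleton.1 hv))
    have p₄ := (IsListPath.singleton y).append p₃ h1 (by
      intro v hv hv'
      obtain rfl := List.mem_singleton.1 hv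
      simp only [List.mem_append, List.mem_map, List.mem_reverse, List.mem_singleton] at hv'
      rcases hv' with (⟨k, -, hk⟩ | hv') | ⟨k, -, hk⟩
      · exact hy k hk
      · exact hxy hv'.symm
      · exact hy k hk)
    have := h.longest _ _ _ p₄ hyj.symm (by simp; omega)
    simp at this
    omega
  have hAA : ∀ i j, i < j → j < i + c → f i ∈ A → f j ∈ A → 1 + i + 1 ≤ j :=
    fun i j hij hj hi hj' =>
      h.length_lt_of_isListPath (IsListPath.singleton x) (by simpa using hx)
        hij hj (hA _ hi).1 (hA _ hj').1
  let S₀ : Finset ℕ := {i ∈ Finset.range c | f (i + 1) ∈ B}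
  let SA : Finset ℕ := {i ∈ Finset.range c | f (i + 1) ∈ A}
  let S₁ : Finset ℕ := SA.image (· + 1)
  let S₂ : Finset ℕ := SA.image (· + 2)
  have hS₀S₁ : Disjoint S₀ S₁ := by
    refine Finset.disjoint_left.2 fun i hi hi' => ?_
    simp only [S₀, S₁, SA, Finset.mem_filter, Finset.mem_range, Finset.mem_image] at hi hi'
    obtain ⟨j, hj, rfl⟩ := hi'
    have := hAB (j + 1) (j + 1 + 1) (by omega) (by omega) (by omega) (hA _ hj.2).1 (hB _ hi.2).1
    omega
  have hS₀S₂ : Disjoint S₀ S₂ := by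
    refine Finset.disjoint_left.2 fun i hi hi' => ?_
    simp only [S₀, S₂, SA, Finset.mem_filter, Finset.mem_range, Finset.mem_image] at hi hi'
    obtain ⟨j, hj, rfl⟩ := hi'
    have := hAB (j + 1) (j + 2 + 1) (by omega) (by omega) (by omega) (hA _ hj.2).1 (hB _ hi.2).1
    omega
  have hS₁S₂ : Disjoint S₁ S₂ := by
    refine Finset.disjoint_left.2 fun i hi hi' => ?_
    simp only [S₁, S₂, SA, Finset.mem_filter, Finset.mem_range, Finset.mem_image] at hi hi'
    obtain ⟨j, hj, rfl⟩ := hi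
    obtain ⟨k, hk, hkj⟩ := hi'
    obtain rfl : j = k + 1 := by omega
    have := hAA (k + 1) (k + 1 + 1) (by omega) (by omega) hk.2 hj.2
    omega
  have hsub : S₀ ∪ S₁ ∪ S₂ ⊆ Finset.range (c + 2) := by
    intro i hi
    simp only [S₀, S₁, S₂, SA, Finset.mem_union, Finset.mem_filter, Finset.mem_range,
      Finset.mem_image] at hi ⊢
    rcases hi with (hi | ⟨j, hj, rfl⟩) | ⟨j, hj, rfl⟩ <;> omega
  have hcard := Finset.card_le_card hsub
  rw [Finset.card_union_of_disjoint (Finset.disjoint_union_left.2 ⟨hS₀S₂, hS₁S₂⟩),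
    Finset.card_union_of_disjoint hS₀S₁, Finset.card_range,
    Finset.card_image_of_injective _ (add_left_injective 1),
    Finset.card_image_of_injective _ (add_left_injective 2)] at hcard
  have k₀ : #B ≤ #S₀ := h.card_le_card_filter B (fun v hv => (hB v hv).2) 1
  have k₁ : #A ≤ #SA := h.card_le_card_filter A (fun v hv => (hA v hv).2) 1
  omega

end IsLongestCycleEnum

namespace IsListPath

variable {V : Type*} {G : SimpleGraph V} {l : List V} {x y z : V}

lemma exists_adj_of_append_singleton (h : IsListPath G (l ++ [z]) x z) (hl : l ≠ []) :
    ∃ w, IsListPath G l x w ∧ G.Adj w z := by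
  refine ⟨l.getLast hl, ⟨h.chain.left_of_append, h.nodup.of_append_left, ?_, ?_⟩, ?_⟩
  · have := h.head
    rwa [List.head?_append_of_ne_nil _ hl] at this
  · exact List.getLast?_eq_some_getLast hl
  · have := (List.isChain_append.1 h.chain).2.2
    exact this _ (by simp [List.getLast?_eq_some_getLast hl]) _ (by simp)

lemma exists_interior (h : IsListPath G l x y) (hz : z ∈ l) (hzx : z ≠ x) (hzy : z ≠ y) :
    ∃ m a b, l = x :: (m ++ [y]) ∧ IsListPath G m a b ∧ G.Adj x a ∧ G.Adj b y := by
  obtain ⟨l', rfl⟩ : ∃ l', l = l' ++ [y] := List.getLast?_eq_some_iff.1 h.last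
  have hl' : l' ≠ [] := by
    rintro rfl
    simp at hz
    exact hzy hz
  obtain ⟨b, hb, hby⟩ := h.exists_adj_of_append_singleton hl'
  obtain ⟨m, rfl⟩ : ∃ m, l' = x :: m := List.head?_eq_some_iff.1 hb.head
  have hm : m ≠ [] := by
    rintro rfl
    simp at hz
    tauto
  have hrev := hb.reverse
  rw [List.reverse_cons] at hrev
  obtain ⟨a, ha, hax⟩ := hrev.exists_adj_of_append_singleton (by simpa using hm)
  exact ⟨m, a, b, rfl, by simpa using ha.reverse, hax.symm, hby⟩

end IsListPath

lemma List.exists_first_split {α : Type*} (p : α → Prop) {l : List α} (h : ∃ a ∈ l, p a) :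
    ∃ l₁ a l₂, l = l₁ ++ a :: l₂ ∧ p a ∧ ∀ b ∈ l₁, ¬ p b := by
  induction l with
  | nil => simp at h
  | cons b l ih =>
    by_cases hb : p b
    · exact ⟨[], b, l, rfl, hb, by simp⟩
    · obtain ⟨l₁, a, l₂, rfl, ha, hl₁⟩ := ih (by
        obtain ⟨a, ha, hpa⟩ := h
        rcases List.mem_cons.1 ha with rfl | ha
        · exact absurd hpa hb
        · exact ⟨a, ha, hpa⟩)
      exact ⟨b :: l₁, a, l₂, rfl, ha, by simpa [hb] using hl₁⟩

lemma List.exists_last_split {α : Type*} (p : α → Prop) {l : List α} (h : ∃ a ∈ l, p a) :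
    ∃ l₁ a l₂, l = l₁ ++ a :: l₂ ∧ p a ∧ ∀ b ∈ l₂, ¬ p b := by
  obtain ⟨l₁, a, l₂, hl, ha, hl₁⟩ := List.exists_first_split p (l := l.reverse) (by simpa using h)
  refine ⟨l₂.reverse, a, l₁.reverse, ?_, ha, by simpa using hl₁⟩
  rw [← List.reverse_reverse l, hl]
  simp

section

variable {V : Type*} {G : SimpleGraph V}

/-- If `y` ends a path that starts at its only vertex `u` of `S` and contains all neighbours of
`y`, then some path between two vertices of `S`, otherwise avoiding `S`, contains `y` and all its
neighbours outside `S`. -/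
lemma exists_interior_path_of_closed_end (hG : ∀ v : V, (G.induce {w | w ≠ v}).Connected)
    {S : Set V} (hS : S.Nontrivial) {u y : V} {Q : List V} (hQ : IsListPath G (u :: Q) u y)
    (hu : u ∈ S) (hQS : ∀ v ∈ Q, v ∉ S) (hyS : y ∉ S) (hN : ∀ v, G.Adj y v → v ∈ u :: Q)
    (hne : ∃ v, G.Adj y v) :
    ∃ P a b s₁ s₂, IsListPath G P a b ∧ s₁ ≠ s₂ ∧ s₁ ∈ S ∧ s₂ ∈ S ∧ G.Adj a s₁ ∧ G.Adj b s₂ ∧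
      (∀ v ∈ P, v ∉ S) ∧ y ∈ P ∧ ∀ v, G.Adj y v → v ∉ S → v ∈ P := by
  obtain ⟨L, x, R, hW, hyx, hL⟩ := List.exists_first_split (fun v => G.Adj y v) (l := u :: Q)
    (hne.imp fun v hv => ⟨hN v hv, hv⟩)
  have hnd := hQ.nodup
  have hRQ : ∀ v ∈ R, v ∈ Q := by
    cases L with
    | nil => simp at hW; simp [hW.2]
    | cons w L => simp at hW; simp [hW.2]; tauto
  rw [hW] at hQ hnd hN
  have hxR := hQ.right_of_append
  have hyR : y ∈ R := by
    rcases List.mem_cons.1 hxR.last_mem with h | h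
    · exact absurd (h ▸ hyx) (G.irrefl)
    · exact h
  obtain ⟨P₁, P₂, s₁, s₂, t, h1, h2, hs₁, hs₂, ht, hd, hP₁S, hP₂S, hP₁R, hP₂R⟩ :=
    exists_two_disjoint_paths hG hS (L ++ [x]).reverse {v | v ∈ R} x u hQ.left_of_append.reverse hu
      (by
        intro v hv hvS
        have : v ∈ u :: Q := by rw [hW]; simp at hv ⊢; tauto
        rcases List.mem_cons.1 this with h | h
        · exact h
        · exact absurd hvS (hQS v h))
      ⟨y, hyR⟩ (fun v hv => hQS v (hRQ v hv))
      (by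
        intro v hv hvR
        have hv' : v ∈ L ∨ v = x := by simpa [or_comm] using hv
        rcases hv' with h | rfl
        · exact (List.nodup_append'.1 hnd).2.2 h (List.mem_cons_of_mem _ hvR)
        · exact (List.nodup_cons.1 hxR.nodup).1 hvR)
  simp only [Set.mem_ofPred_eq] at ht hP₁R hP₂R
  obtain ⟨R₁, R₂, rfl⟩ := List.append_of_mem ht
  obtain ⟨M₁, z, M₂, hM, hyz, hM₂⟩ := List.exists_last_split (fun v => G.Adj y v) (l := x :: R₁)
    ⟨x, by simp, hyx⟩
  have hsplit : x :: (R₁ ++ t :: R₂) = M₁ ++ z :: (M₂ ++ t :: R₂) := by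
    rw [← List.cons_append, hM]; simp
  have hxR' : IsListPath G ((x :: R₁) ++ t :: R₂) x y := by simpa using hxR
  have hndR := List.nodup_append'.1 hxR'.nodup
  have hK₁ : IsListPath G (M₁ ++ [z]) x z := (hsplit ▸ hxR).left_of_append
  have hMsub : ∀ v ∈ M₁ ++ [z], v ∈ x :: R₁ := fun v hv => by
    rw [hM]; simp at hv ⊢; tauto
  have hK : IsListPath G ((M₁ ++ [z] ++ R₂.reverse) ++ [t]) x t := by
    have := hK₁.append hxR'.right_of_append.reverse hyz.symm
      (fun v hv hv' => hndR.2.2 (hMsub v hv) (List.mem_reverse.1 hv'))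
    simpa using this
  have hKt : ∀ v ∈ M₁ ++ [z] ++ R₂.reverse, v = x ∨ v ∈ R₁ ++ t :: R₂ ∧ v ≠ t := by
    intro v hv
    rcases List.mem_append.1 hv with hv | hv
    · have hv' := hMsub v hv
      have hvt : v ≠ t := fun h => hndR.2.2 hv' (by simp [h])
      rcases List.mem_cons.1 hv' with h | h
      · exact Or.inl h
      · exact Or.inr ⟨List.mem_append_left _ h, hvt⟩
    · have hv' := List.mem_reverse.1 hv
      exact Or.inr ⟨by simp [hv'], fun h => (List.nodup_cons.1 hndR.2.1).1 (h ▸ hv')⟩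
  obtain ⟨P₁', rfl⟩ : ∃ P₁', P₁ = x :: P₁' := List.head?_eq_some_iff.1 h1.head
  have h1r := h1.reverse
  rw [List.reverse_cons] at h1r
  have htP₂ : t ∈ P₂ := h2.head_mem
  have hF₁ := h1r.glue hK (by
    intro v hv hv'
    have hv := List.mem_reverse.1 hv
    rcases List.mem_append.1 hv' with hv' | hv'
    · rcases hKt v hv' with h | h
      · exact (List.nodup_cons.1 h1.nodup).1 (h ▸ hv)
      · exact hP₁R v (List.mem_cons_of_mem _ hv) h.1
    · exact hd v (List.mem_cons_of_mem _ hv) (List.mem_singleton.1 hv' ▸ htP₂))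
  rw [← List.append_assoc] at hF₁
  have hF := hF₁.glue h2 (by
    intro v hv hv'
    rcases List.mem_append.1 hv with hv | hv
    · exact hd v (List.mem_cons_of_mem _ (List.mem_reverse.1 hv)) hv'
    · rcases hKt v hv with h | h
      · exact hd v (by simp [h]) hv'
      · exact h.2 (hP₂R v hv' h.1))
  have hs₁₂ : s₁ ≠ s₂ := fun h => hd s₁ h1.last_mem (h ▸ h2.last_mem)
  have hFS : ∀ v ∈ P₁'.reverse ++ (M₁ ++ [z] ++ R₂.reverse) ++ P₂, v ∈ S → v = s₁ ∨ v = s₂ := by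
    intro v hv hvS
    rcases List.mem_append.1 hv with hv | hv
    · rcases List.mem_append.1 hv with hv | hv
      · exact Or.inl (hP₁S v (List.mem_cons_of_mem _ (List.mem_reverse.1 hv)) hvS)
      · rcases hKt v hv with h | h
        · exact Or.inl (hP₁S v (by simp [h]) hvS)
        · exact absurd hvS (hQS v (hRQ v h.1))
    · exact Or.inr (hP₂S v hv hvS)
  have hsub : ∀ v, v ∈ M₁ ++ [z] ∨ v ∈ t :: R₂ →
      v ∈ P₁'.reverse ++ (M₁ ++ [z] ++ R₂.reverse) ++ P₂ := by
    intro v hv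
    rcases hv with hv | hv
    · exact List.mem_append_left _ (List.mem_append_right _ (List.mem_append_left _ hv))
    · rcases List.mem_cons.1 hv with rfl | hv
      · exact List.mem_append_right _ htP₂
      · exact List.mem_append_left _ (List.mem_append_right _ (List.mem_append_right _
          (List.mem_reverse.2 hv)))
  have hyF := hsub y (Or.inr hxR'.right_of_append.last_mem)
  obtain ⟨P, a, b, hP, hPab, has, hbs⟩ := hF.exists_interior hyF (fun h => hyS (h ▸ hs₁))
    (fun h => hyS (h ▸ hs₂))
  have hFnd := hF.nodup
  rw [hP] at hFnd hFS hsub hyF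
  have hmemP : ∀ v ∈ s₁ :: (P ++ [s₂]), v ∉ S → v ∈ P := by
    intro v hv hvS
    simp only [List.mem_cons, List.mem_append, List.not_mem_nil, or_false] at hv
    rcases hv with rfl | hv | rfl
    · exact absurd hs₁ hvS
    · exact hv
    · exact absurd hs₂ hvS
  refine ⟨P, a, b, s₁, s₂, hPab, hs₁₂, hs₁, hs₂, has.symm, hbs, ?_, hmemP y hyF hyS, ?_⟩
  · intro v hv hvS
    rcases hFS v (by simp [hv]) hvS with rfl | rfl
    · exact (List.nodup_cons.1 hFnd).1 (by simp [hv])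
    · exact (List.nodup_append'.1 (List.nodup_cons.1 hFnd).2).2.2 hv (by simp)
  · intro v hyv hvS
    refine hmemP v (hsub v ?_) hvS
    have hv := hN v hyv
    rcases List.mem_append.1 hv with hv | hv
    · exact absurd hyv (hL v hv)
    · rw [hsplit] at hv
      have := hM₂ v
      simp only [List.mem_append, List.mem_cons, List.not_mem_nil, or_false] at hv ⊢
      tauto

end

namespace IsLongestCycleEnum

variable {V : Type*} {G : SimpleGraph V} {f : ℕ → V} {c : ℕ}

open Classical in
/-- The neighbours of `x` on the cycle enumerated by `f`. -/
noncomputable def cycleNeighbors [Fintype V] (G : SimpleGraph V) (f : ℕ → V) (x : V) : Finset V :=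
  {v | G.Adj x v ∧ ∃ k, f k = v}

lemma mem_cycleNeighbors [Fintype V] {x v : V} :
    v ∈ cycleNeighbors G f x ↔ G.Adj x v ∧ ∃ k, f k = v := by
  simp [cycleNeighbors]

/-- If some edge is off the cycle, there is a path with at least two vertices off the cycle whose
first vertex has a neighbour on the cycle. -/
lemma exists_attached_path (h : IsLongestCycleEnum G f c)
    (hG : ∀ v : V, (G.induce {w | w ≠ v}).Connected) {a b : V} (ha : ∀ k, f k ≠ a)
    (hb : ∀ k, f k ≠ b) (hab : G.Adj a b) :
    ∃ Q x y u, IsListPath G Q x y ∧ (∀ v ∈ Q, ∀ k, f k ≠ v) ∧ (∃ k, f k = u) ∧ G.Adj x u ∧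
      2 ≤ Q.length := by
  obtain ⟨l, t, z, hl, ht, ⟨k, hk⟩, -, hlT, hlZ⟩ := exists_isListPath_between (hG (f 0))
    (T := {a, b}) (Z := Set.range f) ⟨a, by simp, fun h => ha 0 h.symm⟩
    ⟨f 1, ⟨1, rfl⟩, fun he => h.inj 0 1 (by omega) (by have := h.three_le; omega) he.symm⟩
  obtain ⟨m, rfl⟩ : ∃ m, l = m ++ [z] := List.getLast?_eq_some_iff.1 hl.last
  have htoff : ∀ k, f k ≠ t := by
    rcases ht with rfl | rfl
    exacts [ha, hb]
  have hm : m ≠ [] := by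
    rintro rfl
    have := hl.head
    simp at this
    exact htoff k (hk.trans this)
  obtain ⟨w, hw, hwz⟩ := hl.exists_adj_of_append_singleton hm
  obtain ⟨t', ht'T, ht'off, htt'⟩ : ∃ t', t' ∈ ({a, b} : Set V) ∧ (∀ k, f k ≠ t') ∧
      G.Adj t t' := by
    rcases ht with rfl | rfl
    exacts [⟨b, by simp, hb, hab⟩, ⟨a, by simp, ha, hab.symm⟩]
  refine ⟨m.reverse ++ [t'], w, t', z, hw.reverse.append (IsListPath.singleton t') htt' ?_, ?_,
    ⟨k, hk⟩, hwz, ?_⟩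
  · intro v hv hv'
    have hv := List.mem_reverse.1 hv
    have hv' := List.mem_singleton.1 hv'
    have := hlT v (List.mem_append_left _ hv) (hv' ▸ ht'T)
    exact G.irrefl (this ▸ hv' ▸ htt')
  · intro v hv j hj
    rcases List.mem_append.1 hv with hv | hv
    · have hv := List.mem_reverse.1 hv
      have := hlZ v (List.mem_append_left _ hv) ⟨j, hj⟩
      exact (List.nodup_append'.1 hl.nodup).2.2 hv (by simp [this])
    · exact ht'off j (hj.trans (List.mem_singleton.1 hv))
  · have := List.length_pos_of_ne_nil hm
    simp
    omega

variable [Fintype V] [DecidableEq V] [DecidableRel G.Adj]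

lemma exists_ends_of_adj (h : IsLongestCycleEnum G f c)
    (hG : ∀ v : V, (G.induce {w | w ≠ v}).Connected) {a b : V} (ha : ∀ k, f k ≠ a)
    (hb : ∀ k, f k ≠ b) (hab : G.Adj a b) {d : ℕ} (hd2 : 2 ≤ d) (hd : ∀ v, d ≤ G.degree v) :
    ∃ P x y u w, IsListPath G P x y ∧ (∀ v ∈ P, ∀ k, f k ≠ v) ∧ 2 ≤ P.length ∧ u ≠ w ∧
      u ∈ cycleNeighbors G f x ∧ w ∈ cycleNeighbors G f y ∧
      d + 1 ≤ P.length + #(cycleNeighbors G f x) ∧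
      d + 1 ≤ P.length + #(cycleNeighbors G f y) := by
  classical
  let IsAttached : ℕ → Prop := fun n => ∃ Q x y u, IsListPath G Q x y ∧
    (∀ v ∈ Q, ∀ k, f k ≠ v) ∧ (∃ k, f k = u) ∧ G.Adj x u ∧ Q.length = n
  obtain ⟨Q₀, x₀, y₀, u₀, hQ₀, hoff₀, hu₀, hxu₀, hlen₀⟩ := h.exists_attached_path hG ha hb hab
  have hatt₀ : IsAttached Q₀.length := ⟨Q₀, x₀, y₀, u₀, hQ₀, hoff₀, hu₀, hxu₀, rfl⟩
  have hge := Nat.le_findGreatest hQ₀.nodup.length_le_card hatt₀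
  obtain ⟨Q, x, y, u, hQ, hoff, hu, hxu, hlen⟩ :=
    Nat.findGreatest_spec hQ₀.nodup.length_le_card hatt₀
  have hmax : ∀ Q' x' y' u', IsListPath G Q' x' y' → (∀ v ∈ Q', ∀ k, f k ≠ v) →
      (∃ k, f k = u') → G.Adj x' u' → Q'.length ≤ Q.length :=
    fun Q' x' y' u' h1 h2 h3 h4 =>
      (Nat.le_findGreatest h1.nodup.length_le_card ⟨Q', x', y', u', h1, h2, h3, h4, rfl⟩).trans_eq
        hlen.symm
  have hQ2 : 2 ≤ Q.length := by rw [hlen]; exact hlen₀.trans hge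
  have hstuck : ∀ Q' x' y' u', IsListPath G Q' x' y' → (∀ v ∈ Q', ∀ k, f k ≠ v) →
      (∃ k, f k = u') → G.Adj x' u' → Q'.length = Q.length →
      (∀ v, G.Adj y' v → v ∈ Q' ∨ ∃ k, f k = v) ∧
        d + 1 ≤ Q.length + #(cycleNeighbors G f y') := by
    intro Q' x' y' u' h1 h2 h3 h4 h5
    have hN : ∀ v, G.Adj y' v → v ∈ Q' ∨ ∃ k, f k = v := by
      intro v hv
      by_contra! hcon
      have := hmax (Q' ++ [v]) x' v u'
        (h1.append (IsListPath.singleton v) hv (fun w hw hw' =>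
          hcon.1 (List.mem_singleton.1 hw' ▸ hw)))
        (by
          intro w hw k
          rcases List.mem_append.1 hw with hw | hw
          · exact h2 w hw k
          · exact List.mem_singleton.1 hw ▸ hcon.2 k) h3 h4
      simp at this
      omega
    refine ⟨hN, ?_⟩
    have hsub : G.neighborFinset y' ⊆ Q'.toFinset.erase y' ∪ cycleNeighbors G f y' := by
      intro v hv
      rw [mem_neighborFinset] at hv
      rw [Finset.mem_union, Finset.mem_erase, List.mem_toFinset, mem_cycleNeighbors]
      rcases hN v hv with h' | h'
      · exact Or.inl ⟨hv.ne', h'⟩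
      · exact Or.inr ⟨hv, h'⟩
    have hcard := (Finset.card_le_card hsub).trans (Finset.card_union_le _ _)
    rw [card_neighborFinset_eq_degree, Finset.card_erase_of_mem (by simpa using h1.last_mem),
      List.toFinset_card_of_nodup h1.nodup, h5] at hcard
    have := hd y'
    omega
  obtain ⟨hN, hdy⟩ := hstuck Q x y u hQ hoff hu hxu rfl
  by_cases hw : ∃ w, G.Adj y w ∧ (∃ k, f k = w) ∧ u ≠ w
  · obtain ⟨w, hyw, hwf, huw⟩ := hw
    exact ⟨Q, x, y, u, w, hQ, hoff, hQ2, huw, mem_cycleNeighbors.2 ⟨hxu, hu⟩,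
      mem_cycleNeighbors.2 ⟨hyw, hwf⟩,
      (hstuck Q.reverse y x w hQ.reverse (by simpa using hoff) hwf hyw (by simp)).2, hdy⟩
  · push Not at hw
    have hpath : IsListPath G ([u] ++ Q) u y := (IsListPath.singleton u).append hQ hxu.symm (by
      intro v hv hvQ
      obtain rfl := List.mem_singleton.1 hv
      obtain ⟨k, hk⟩ := hu
      exact hoff v hvQ k hk)
    have hnontriv : (Set.range f).Nontrivial :=
      ⟨f 0, ⟨0, rfl⟩, f 1, ⟨1, rfl⟩, h.inj 0 1 (by omega) (by have := h.three_le; omega)⟩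
    obtain ⟨P, x', y', s₁, s₂, hP, hs, hs₁, hs₂, hxs, hys, hPoff, hyP, hNP⟩ :=
      exists_interior_path_of_closed_end hG hnontriv hpath hu
        (fun v hv ⟨k, hk⟩ => hoff v hv k hk) (fun ⟨k, hk⟩ => hoff y hQ.last_mem k hk)
        (fun v hv => by
          by_cases hvf : ∃ k, f k = v
          · simp [hw v hv hvf]
          · exact List.mem_cons_of_mem _ ((hN v hv).resolve_right hvf))
        ((G.degree_pos_iff_exists_adj y).1 (by have := hd y; omega))
    have hsub : (insert y (G.neighborFinset y)).erase u ⊆ P.toFinset := by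
      intro v hv
      rw [Finset.mem_erase, Finset.mem_insert, mem_neighborFinset] at hv
      rw [List.mem_toFinset]
      rcases hv.2 with rfl | hyv
      · exact hyP
      · exact hNP v hyv fun hvf => hv.1 (hw v hyv hvf).symm
    have hcard := (Finset.pred_card_le_card_erase.trans (Finset.card_le_card hsub)).trans
      (List.toFinset_card_le P)
    rw [Finset.card_insert_of_notMem (by simp), card_neighborFinset_eq_degree] at hcard
    have hdP : d ≤ P.length := by have := hd y; omega
    have hmx := mem_cycleNeighbors.2 ⟨hxs, hs₁⟩
    have hmy := mem_cycleNeighbors.2 ⟨hys, hs₂⟩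
    have := Finset.card_pos.2 ⟨_, hmx⟩
    have := Finset.card_pos.2 ⟨_, hmy⟩
    exact ⟨P, x', y', s₁, s₂, hP, fun v hv k hk => hPoff v hv ⟨k, hk⟩, by omega, hs, hmx, hmy,
      by omega, by omega⟩

/-- A longest cycle of a 2-connected graph with `n + 2 ≤ 3 δ` is dominating. -/
lemma not_adj_of_off (h : IsLongestCycleEnum G f c)
    (hG : ∀ v : V, (G.induce {w | w ≠ v}).Connected) {d : ℕ} (hd : ∀ v, d ≤ G.degree v)
    (hdn : Fintype.card V + 2 ≤ 3 * d) {a b : V} (ha : ∀ k, f k ≠ a) (hb : ∀ k, f k ≠ b) :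
    ¬ G.Adj a b := by
  intro hab
  have h3 := h.three_le
  have hcn := h.add_length_le_card (P := []) (by simp) (by simp)
  simp at hcn
  obtain ⟨P, x, y, u, w, hP, hoff, hP2, huw, hu, hw, hdx, hdy⟩ :=
    h.exists_ends_of_adj hG ha hb hab (d := d) (by omega) hd
  obtain ⟨hxu, i, rfl⟩ := mem_cycleNeighbors.1 hu
  obtain ⟨hyw, j, rfl⟩ := mem_cycleNeighbors.1 hw
  obtain ⟨q, hq1, hq2, hq⟩ := h.exists_mem_window i j
  have hqi : q ≠ i := fun he => huw (by rw [← hq, he])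
  have hs := h.shift i
  have hmem : ∀ z, ∀ v ∈ cycleNeighbors G f z, G.Adj z v ∧ ∃ k, f (k + i) = v := by
    intro z v hv
    obtain ⟨hzv, k, rfl⟩ := mem_cycleNeighbors.1 hv
    obtain ⟨k', h1, -, h2⟩ := h.exists_mem_window i k
    exact ⟨hzv, k' - i, by rw [Nat.sub_add_cancel h1, h2]⟩
  have := hs.two_mul_card_add_card_le hP (fun v hv k => hoff v hv (k + i)) hP2 (hmem x) (hmem y)
    (q := q - i) (by omega) (by omega) (by simpa using hu)
    (by rw [Nat.sub_add_cancel hq1, hq]; exact hw)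
  have := h.add_length_le_card hP.nodup hoff
  omega

lemma false_of_consecutive (h : IsLongestCycleEnum G f c) {d : ℕ} (hd : ∀ v, d ≤ G.degree v)
    (hdn : Fintype.card V + 2 ≤ 3 * d)
    (hind : ∀ a b, (∀ k, f k ≠ a) → (∀ k, f k ≠ b) → ¬ G.Adj a b) {x y : V}
    (hx : ∀ k, f k ≠ x) (hy : ∀ k, f k ≠ y) {i : ℕ} (hxi : G.Adj x (f i))
    (hyi : G.Adj y (f (i + 1))) : False := by
  have h3 := h.three_le
  by_cases hxy : x = y
  · subst hxy
    have := h.length_lt_of_isListPath (IsListPath.singleton x) (by simpa using hx)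
      (show i < i + 1 by omega) (by omega) hxi hyi
    simp at this
  · have hmem : ∀ z, (∀ k, f k ≠ z) → ∀ v ∈ G.neighborFinset z,
        G.Adj z v ∧ ∃ k, f (k + i) = v := by
      intro z hz v hv
      rw [mem_neighborFinset] at hv
      refine ⟨hv, ?_⟩
      by_contra! hcon
      refine hind z v hz (fun k hk => ?_) hv
      obtain ⟨k', h1, -, h2⟩ := h.exists_mem_window i k
      exact hcon (k' - i) (by rw [Nat.sub_add_cancel h1, h2, hk])
    have h1 := (h.shift i).card_le_of_consecutive hxy (fun k => hx _) (fun k => hy _) (hmem x hx)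
      (hmem y hy) (by simpa using hxi) (by simpa [add_comm] using hyi)
    have h2 := h.add_length_le_card (P := [x, y]) (by simpa using hxy) (by
      intro v hv
      rcases List.mem_cons.1 hv with rfl | hv
      · exact hx
      · exact List.mem_singleton.1 hv ▸ hy)
    simp only [card_neighborFinset_eq_degree] at h1
    simp at h2
    have := hd x
    have := hd y
    omega

end IsLongestCycleEnum

/-- If `G` is a 2-connected graph on `n` vertices with `δ(G) ≥ (n+2)/3`, then every longest
cycle of `G` is strongly dominating. -/
theorem longest_cycle_strongly_dominating
    {V : Type*} [Fintype V] [DecidableEq V] (G : SimpleGraph V) [DecidableRel G.Adj]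
    (h2 : TwoConnected G)
    (hδ : ((Fintype.card V : ℚ) + 2) / 3 ≤ (G.minDegree : ℚ)) :
    ∀ (v : V) (p : G.Walk v v), p.IsCycle →
      (∀ (w : V) (q : G.Walk w w), q.IsCycle → q.length ≤ p.length) →
      IsStronglyDominating G p := by
  intro v p hp hmax
  have hdn : Fintype.card V + 2 ≤ 3 * G.minDegree := by
    have : (Fintype.card V : ℚ) + 2 ≤ 3 * G.minDegree := by linarith
    exact_mod_cast this
  have hd := G.minDegree_le_degree
  have h := hp.isLongestCycleEnum hmax
  have hoff : ∀ a, a ∉ p.support → ∀ k, p.getVert (k % p.length) ≠ a := fun a ha k hk =>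
    ha (hk ▸ p.getVert_mem_support _)
  have hind := fun a b ha hb => h.not_adj_of_off h2.2 hd hdn (a := a) (b := b) ha hb
  refine ⟨fun a b ha hb => hind a b (hoff a ha) (hoff b hb), ?_⟩
  rintro a b ⟨x, hx, hxa⟩ ⟨y, hy, hyb⟩ hab
  rw [Walk.mk_mem_edges_iff_exists] at hab
  obtain ⟨i, hi, he⟩ := hab
  have h0 : p.getVert (i % p.length) = p.getVert i := by rw [Nat.mod_eq_of_lt hi]
  have h1 : p.getVert ((i + 1) % p.length) = p.getVert (i + 1) := by
    rcases Nat.lt_or_ge (i + 1) p.length with hlt | hge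
    · rw [Nat.mod_eq_of_lt hlt]
    · rw [show i + 1 = p.length by omega]
      simp
  rw [← h0, ← h1, Sym2.eq_iff] at he
  rcases he with ⟨rfl, rfl⟩ | ⟨rfl, rfl⟩
  · exact h.false_of_consecutive hd hdn hind (hoff x hx) (hoff y hy) hxa hyb
  · exact h.false_of_consecutive hd hdn hind (hoff y hy) (hoff x hx) hyb hxa
end
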